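/- arXiv:1611.08260 — 6 statements merged into one kernel-verified Lean document; each statement's English description precedes it below -/
import Mathlib

section
/- Let P, X, Y be metric spaces, let M : P × X ⇒ Y be a multifunction, let ȳ ∈ M(p̄, x̄), and define S(p) := {x ∈ X : ȳ ∈ M(p,x)} and M_{p̄}(x) := M(p̄,x). If M has the restricted calmness property with respect to p at (p̄, x̄, ȳ) and M_{p̄} is metrically subregular at (x̄, ȳ), then S is calm at (p̄, x̄). -/
open Filter Topology Metric

noncomputable section

/-- The ℓ² distance on the product of two metric spaces. -/
def dist2 {X Y : Type*} [MetricSpace X] [MetricSpace Y] (a b : X × Y) : ℝ :=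
  Real.sqrt (dist a.1 b.1 ^ 2 + dist a.2 b.2 ^ 2)

/-- Distance from a point to a set with respect to the ℓ² product metric. -/
def infDist2 {X Y : Type*} [MetricSpace X] [MetricSpace Y] (a : X × Y) (B : Set (X × Y)) : ℝ :=
  sInf (dist2 a '' B)

/-- The multifunction `F : Y ⇒ X` is calm at `(yb, xb) ∈ gph F`. -/
def CalmAt {Y X : Type*} [MetricSpace Y] [MetricSpace X] (F : Y → Set X) (yb : Y) (xb : X) :
    Prop :=
  ∃ κ : ℝ, 0 ≤ κ ∧ ∃ ε : ℝ, 0 < ε ∧ ∀ y x, dist y yb < ε → dist x xb < ε → x ∈ F y →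
    infDist x (F yb) ≤ κ * dist y yb

/-- The multifunction `M : X ⇒ Y` is metrically subregular at `(xb, yb) ∈ gph M`
(with the convention that the distance to the empty set is `+∞`). -/
def MetrSubregAt {X Y : Type*} [MetricSpace X] [MetricSpace Y] (M : X → Set Y) (xb : X)
    (yb : Y) : Prop :=
  ∃ κ : ℝ, 0 ≤ κ ∧ ∃ ε : ℝ, 0 < ε ∧ ∀ x, dist x xb < ε →
    EMetric.infEdist x {x' | yb ∈ M x'} ≤ ENNReal.ofReal κ * EMetric.infEdist yb (M x)

/-- `M : P × X ⇒ Y` has the restricted calmness property with respect to `p` at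
`(pb, xb, yb)`, the distance in `X × Y` being the ℓ² product metric. -/
def RestrCalm {P X Y : Type*} [MetricSpace P] [MetricSpace X] [MetricSpace Y]
    (M : P × X → Set Y) (pb : P) (xb : X) (yb : Y) : Prop :=
  ∃ L : ℝ, 0 ≤ L ∧ ∃ ε : ℝ, 0 < ε ∧ ∀ p x, dist p pb < ε → dist x xb < ε → yb ∈ M (p, x) →
    infDist2 (x, yb) {z : X × Y | z.2 ∈ M (pb, z.1)} ≤ L * dist p pb

theorem dist_fst_le_dist2 {X Y : Type*} [MetricSpace X] [MetricSpace Y] (a b : X × Y) :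
    dist a.1 b.1 ≤ dist2 a b :=
  Real.le_sqrt_of_sq_le (le_add_of_nonneg_right (sq_nonneg _))

theorem dist_snd_le_dist2 {X Y : Type*} [MetricSpace X] [MetricSpace Y] (a b : X × Y) :
    dist a.2 b.2 ≤ dist2 a b :=
  Real.le_sqrt_of_sq_le (le_add_of_nonneg_left (sq_nonneg _))

theorem exists_dist2_lt_of_infDist2_lt {X Y : Type*} [MetricSpace X] [MetricSpace Y] {a : X × Y}
    {B : Set (X × Y)} (hB : B.Nonempty) {r : ℝ} (h : infDist2 a B < r) :
    ∃ b ∈ B, dist2 a b < r := by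
  obtain ⟨_, ⟨b, hb, rfl⟩, hr⟩ := exists_lt_of_csInf_lt (hB.image _) h
  exact ⟨b, hb, hr⟩

theorem infDist_le_of_infEDist_le {X Y : Type*} [MetricSpace X] [MetricSpace Y] {S : Set X}
    {T : Set Y} {x : X} {y y' : Y} {κ : ℝ} (hκ : 0 ≤ κ)
    (h : infEDist x S ≤ ENNReal.ofReal κ * infEDist y T) (hy' : y' ∈ T) :
    infDist x S ≤ κ * dist y y' := by
  refine ENNReal.toReal_le_of_le_ofReal (by positivity) (h.trans ?_)
  rw [ENNReal.ofReal_mul hκ, ← edist_dist]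
  gcongr
  exact infEDist_le_edist_of_mem hy'

/-- Restricted calmness with respect to `p` together with metric subregularity of
`M_pb` imply calmness of the implicit multifunction `S`. -/
theorem stmt0 {P X Y : Type*} [MetricSpace P] [MetricSpace X] [MetricSpace Y]
    (M : P × X → Set Y) (pb : P) (xb : X) (yb : Y)
    (hbar : yb ∈ M (pb, xb))
    (hrc : RestrCalm M pb xb yb)
    (hsub : MetrSubregAt (fun x => M (pb, x)) xb yb) :
    CalmAt (fun p => {x | yb ∈ M (p, x)}) pb xb := by
  obtain ⟨L, hL, ε₁, hε₁, hrc⟩ := hrc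
  obtain ⟨κ, hκ, ε₂, hε₂, hsub⟩ := hsub
  refine ⟨(1 + κ) * L, by positivity, min ε₁ (min (ε₂ / 2) (ε₂ / 2 / (L + 1))), by positivity,
    fun p x hp hx hpx => ?_⟩
  simp only [lt_min_iff] at hp hx
  have hLp : L * dist p pb < ε₂ / 2 := by
    have := (lt_div_iff₀ (by positivity)).1 hp.2.2
    nlinarith [dist_nonneg (x := p) (y := pb)]
  by_contra! hlt
  rw [mul_assoc, ← lt_div_iff₀' (by positivity)] at hlt
  obtain ⟨r, hr, hr'⟩ := exists_between (lt_min hLp hlt)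
  obtain ⟨hrε, hrx⟩ := lt_min_iff.1 hr'
  rw [lt_div_iff₀' (by positivity)] at hrx
  obtain ⟨⟨x', y'⟩, hy', hd⟩ := exists_dist2_lt_of_infDist2_lt ⟨(xb, yb), hbar⟩
    ((hrc p x hp.1 hx.1 hpx).trans_lt hr)
  have hxx' : dist x x' < r := (dist_fst_le_dist2 _ _).trans_lt hd
  have hyy' : dist yb y' < r := (dist_snd_le_dist2 _ _).trans_lt hd
  have hx' : dist x' xb < ε₂ := by
    linarith [dist_triangle_left x' xb x, hx.2.1]
  have hinf := infDist_le_of_infEDist_le hκ (hsub x' hx') hy'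
  have htri := infDist_le_infDist_add_dist (s := {x | yb ∈ M (pb, x)}) (x := x) (y := x')
  have := mul_le_mul_of_nonneg_left hyy'.le hκ
  linarith
end
end

section
/- Let P, X, Y be metric spaces, let M : P × X ⇒ Y be a multifunction with ȳ ∈ M(p̄, x̄), and define S(p) := {x ∈ X : ȳ ∈ M(p,x)}. If S is calm at (p̄, x̄), then M has the restricted calmness property with respect to p at (p̄, x̄, ȳ). -/
open Filter Topology Metric

noncomputable section

theorem dist2_mk_same {X Y : Type*} [MetricSpace X] [MetricSpace Y] (x x' : X) (y : Y) :
    dist2 (x, y) (x', y) = dist x x' := by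
  simp [dist2, Real.sqrt_sq dist_nonneg]

theorem infDist2_le_dist2 {X Y : Type*} [MetricSpace X] [MetricSpace Y] {a b : X × Y}
    {B : Set (X × Y)} (hb : b ∈ B) : infDist2 a B ≤ dist2 a b := by
  refine csInf_le ⟨0, ?_⟩ (Set.mem_image_of_mem _ hb)
  rintro _ ⟨c, -, rfl⟩
  exact Real.sqrt_nonneg _

/-- The distance to a set is at most the distance to its slice at height `y`. -/
theorem infDist2_le_infDist_slice {X Y : Type*} [MetricSpace X] [MetricSpace Y] (x : X) (y : Y)
    {B : Set (X × Y)} (hB : {x' | (x', y) ∈ B}.Nonempty) :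
    infDist2 (x, y) B ≤ infDist x {x' | (x', y) ∈ B} :=
  (le_infDist hB).2 fun x' hx' =>
    (infDist2_le_dist2 (b := (x', y)) hx').trans_eq (dist2_mk_same x x' y)

/-- If the implicit multifunction `S` is calm at `(pb, xb)`, then `M` has the restricted
calmness property with respect to `p` at `(pb, xb, yb)`. -/
theorem stmt1 {P X Y : Type*} [MetricSpace P] [MetricSpace X] [MetricSpace Y]
    (M : P × X → Set Y) (pb : P) (xb : X) (yb : Y)
    (hbar : yb ∈ M (pb, xb))
    (hcalm : CalmAt (fun p => {x | yb ∈ M (p, x)}) pb xb) :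
    RestrCalm M pb xb yb := by
  obtain ⟨κ, hκ, ε, hε, h⟩ := hcalm
  refine ⟨κ, hκ, ε, hε, fun p x hp hx hM => ?_⟩
  exact (infDist2_le_infDist_slice x yb (B := {z : X × Y | z.2 ∈ M (pb, z.1)})
    ⟨xb, hbar⟩).trans (h p x hp hx hM)
end
end

section
/- Let S(p) := {x ∈ ℝⁿ : 0 ∈ A(p)x + b(p) + Q(x)}, where A : ℝˡ → ℝ^{m×n} and b : ℝˡ → ℝᵐ are Lipschitz continuous near p̄, Q : ℝⁿ ⇒ ℝᵐ is a multifunction whose graph is a union of finitely many convex polyhedra, and (p̄, x̄) ∈ gph S. Then S is calm at (p̄, x̄). -/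
open Filter Topology Metric Set

noncomputable section

abbrev Es (k : ℕ) : Type := EuclideanSpace ℝ (Fin k)

/-- A convex polyhedron: a set defined by finitely many affine inequalities. -/
def IsPolyhedron {E : Type*} [NormedAddCommGroup E] [NormedSpace ℝ E] (C : Set E) : Prop :=
  ∃ (k : ℕ) (f : Fin k → (E →L[ℝ] ℝ)) (c : Fin k → ℝ), C = {z | ∀ i, f i z ≤ c i}

/-- The homogeneous Hoffman error bound: for every finite system of linear inequalities
`a i v ≤ 0` the distance to the solution cone is controlled by the largest violation. -/
def HasHoffmanBound (E : Type*) [NormedAddCommGroup E] [NormedSpace ℝ E] : Prop :=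
  ∀ (ι : Type) [Finite ι] (a : ι → (E →L[ℝ] ℝ)), ∃ κ : ℝ, 0 ≤ κ ∧ ∀ (v : E) (ρ : ℝ), 0 ≤ ρ →
    (∀ i, a i v ≤ ρ) → ∃ v' : E, (∀ i, a i v' ≤ 0) ∧ ‖v - v'‖ ≤ κ * ρ

theorem HasHoffmanBound.of_equiv {E F : Type*} [NormedAddCommGroup E] [NormedSpace ℝ E]
    [NormedAddCommGroup F] [NormedSpace ℝ F] (hE : HasHoffmanBound E) (e : E ≃L[ℝ] F) :
    HasHoffmanBound F := by
  intro ι _ a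
  obtain ⟨κ, hκ, h⟩ := hE ι fun i => (a i).comp (e : E →L[ℝ] F)
  refine ⟨‖(e : E →L[ℝ] F)‖ * κ, by positivity, fun v ρ hρ hv => ?_⟩
  obtain ⟨v', hv', hd⟩ := h (e.symm v) ρ hρ (by simpa using hv)
  refine ⟨e v', by simpa using hv', ?_⟩
  calc ‖v - e v'‖ = ‖(e : E →L[ℝ] F) (e.symm v - v')‖ := by simp
    _ ≤ ‖(e : E →L[ℝ] F)‖ * ‖e.symm v - v'‖ := ContinuousLinearMap.le_opNorm _ _
    _ ≤ ‖(e : E →L[ℝ] F)‖ * (κ * ρ) := by gcongr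
    _ = _ := by ring

/-- Finitely many half-lines in `ℝ` that are pairwise compatible have a common point within `δ` of
any `t` violating none of them by more than `δ`. -/
theorem exists_dist_le_of_pairwise_compatible {ι : Type*} [Finite ι] (P N : Set ι) (U : ι → ℝ)
    (hPN : ∀ i ∈ P, ∀ j ∈ N, U j ≤ U i) {t δ : ℝ} (hδ : 0 ≤ δ)
    (hP : ∀ i ∈ P, t ≤ U i + δ) (hN : ∀ j ∈ N, U j - δ ≤ t) :
    ∃ t', (∀ i ∈ P, t' ≤ U i) ∧ (∀ j ∈ N, U j ≤ t') ∧ |t - t'| ≤ δ := by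
  by_cases ht : ∀ i ∈ P, t ≤ U i
  · rcases N.eq_empty_or_nonempty with rfl | hne
    · exact ⟨t, ht, by simp, by simpa using hδ⟩
    · obtain ⟨j, hj, hmax⟩ := N.toFinite.exists_maximalFor U N hne
      have hmax' : ∀ k ∈ N, U k ≤ U j := fun k hk => (le_total (U k) (U j)).elim id (hmax hk)
      refine ⟨max t (U j), fun i hi => max_le (ht i hi) (hPN i hi j hj),
        fun k hk => (hmax' k hk).trans (le_max_right _ _), ?_⟩
      have := hN j hj
      rw [abs_le]
      rcases max_cases t (U j) with h | h <;> constructor <;> linarith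
  · push Not at ht
    obtain ⟨i₀, hi₀, hlt⟩ := ht
    obtain ⟨i, hi, hmin⟩ := P.toFinite.exists_minimalFor U P ⟨i₀, hi₀⟩
    have hmin' : ∀ k ∈ P, U i ≤ U k := fun k hk => (le_total (U i) (U k)).elim id (hmin hk)
    refine ⟨U i, hmin', fun j hj => hPN i hi j hj, ?_⟩
    have h1 := hP i hi
    have h2 := hmin' i₀ hi₀
    rw [abs_le]
    constructor <;> linarith

/-- One step of Fourier–Motzkin elimination. -/
theorem HasHoffmanBound.prod_real {E : Type*} [NormedAddCommGroup E] [NormedSpace ℝ E]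
    (hE : HasHoffmanBound E) : HasHoffmanBound (E × ℝ) := by
  classical
  intro ι _ a
  have := Fintype.ofFinite ι
  set a' : ι → (E →L[ℝ] ℝ) := fun i => (a i).comp (ContinuousLinearMap.inl ℝ E ℝ) with ha'
  set α : ι → ℝ := fun i => a i (0, 1) with hα
  have hsplit : ∀ i x t, a i (x, t) = a' i x + α i * t := by
    intro i x t
    have h : ((x, t) : E × ℝ) = (x, 0) + t • ((0, 1) : E × ℝ) := by simp
    rw [h, map_add, map_smul]
    simp [ha', hα, mul_comm]
  let b : ι × ι → (E →L[ℝ] ℝ) := fun q =>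
    if 0 < α q.1 ∧ α q.2 < 0 then (-α q.2) • a' q.1 + α q.1 • a' q.2
    else if α q.1 = 0 then a' q.1 else 0
  obtain ⟨κ, hκ, h⟩ := hE (ι × ι) b
  set M : ℝ := ∑ i, |α i| with hM
  have hM0 : 0 ≤ M := by positivity
  have hαM : ∀ i, |α i| ≤ M := fun i =>
    Finset.single_le_sum (f := fun i => |α i|) (fun _ _ => abs_nonneg _) (Finset.mem_univ i)
  set C : ℝ := 1 + 2 * M with hC
  have hC0 : 0 ≤ C := by positivity
  set D : ℝ := ∑ i, (1 + ‖a' i‖ * (κ * C)) / |α i| with hD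
  have hD0 : 0 ≤ D := by positivity
  refine ⟨κ * C + D, by positivity, ?_⟩
  rintro ⟨x, t⟩ ρ hρ hv
  simp only [hsplit] at hv
  obtain ⟨x', hx', hd⟩ := h x (C * ρ) (by positivity) (by
    rintro ⟨i, j⟩
    by_cases hij : 0 < α i ∧ α j < 0
    · simp only [b, hij, and_self, if_true, add_apply, smul_apply, smul_eq_mul]
      have h1 := mul_le_mul_of_nonneg_left (hv i) (neg_nonneg.2 hij.2.le)
      have h2 := mul_le_mul_of_nonneg_left (hv j) hij.1.le
      have h3 := mul_le_mul_of_nonneg_right (hαM i) hρ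
      have h4 := mul_le_mul_of_nonneg_right (hαM j) hρ
      rw [abs_of_pos hij.1] at h3
      rw [abs_of_neg hij.2] at h4
      rw [hC]
      linarith
    · simp only [b, hij, if_false]
      have h1 : 0 ≤ M * ρ := by positivity
      split_ifs with h0
      · have := hv i
        rw [h0] at this
        rw [hC]
        linarith
      · rw [zero_apply]; positivity)
  have hviol : ∀ i, a' i x' + α i * t ≤ (1 + ‖a' i‖ * (κ * C)) * ρ := by
    intro i
    have h1 : a' i (x' - x) ≤ ‖a' i‖ * (κ * (C * ρ)) :=
      (le_abs_self _).trans (((a' i).le_opNorm _).trans (by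
        rw [norm_sub_rev]; gcongr))
    rw [map_sub] at h1
    have := hv i
    linarith
  have hbd : ∀ i, (1 + ‖a' i‖ * (κ * C)) / |α i| * ρ ≤ D * ρ := fun i => by
    gcongr
    exact Finset.single_le_sum (f := fun i => (1 + ‖a' i‖ * (κ * C)) / |α i|)
      (fun _ _ => by positivity) (Finset.mem_univ i)
  obtain ⟨t', hP, hN, htt⟩ := exists_dist_le_of_pairwise_compatible
    {i | 0 < α i} {j | α j < 0} (fun i => -a' i x' / α i) (t := t) (δ := D * ρ)
    (by
      intro i hi j hj
      have hi' : 0 < α i := hi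
      have hj' : α j < 0 := hj
      have := hx' (i, j)
      simp only [b, hi', hj', and_self, if_true, add_apply, smul_apply, smul_eq_mul] at this
      rw [div_le_iff_of_neg hj', div_mul_eq_mul_div, div_le_iff₀ hi']
      linarith)
    (by positivity)
    (by
      intro i hi
      have hi' : 0 < α i := hi
      refine le_trans ?_ (add_le_add_right (hbd i) _)
      rw [abs_of_pos hi', div_mul_eq_mul_div, ← add_div, le_div_iff₀ hi']
      have := hviol i
      linarith)
    (by
      intro i hi
      have hi' : α i < 0 := hi
      refine le_trans (sub_le_sub_left (hbd i) _) ?_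
      rw [abs_of_neg hi', div_mul_eq_mul_div, div_neg, sub_neg_eq_add, ← add_div,
        div_le_iff_of_neg hi']
      have := hviol i
      linarith)
  refine ⟨(x', t'), fun i => ?_, ?_⟩
  · rw [hsplit]
    rcases lt_trichotomy (α i) 0 with h0 | h0 | h0
    · have := hN i h0
      rw [div_le_iff_of_neg h0] at this
      linarith
    · have := hx' (i, i)
      simp only [b, h0, lt_irrefl, and_self, if_false, if_true] at this
      rw [h0]
      linarith
    · have := hP i h0
      rw [le_div_iff₀ h0] at this
      linarith
  · have h1 : 0 ≤ D * ρ := by positivity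
    have h2 : 0 ≤ κ * (C * ρ) := by positivity
    rw [Prod.mk_sub_mk, Prod.norm_mk, Real.norm_eq_abs]
    exact max_le (by linarith) (by linarith)

theorem hasHoffmanBound_of_finrank_eq (d : ℕ) (E : Type) [NormedAddCommGroup E]
    [NormedSpace ℝ E] [FiniteDimensional ℝ E] (hd : Module.finrank ℝ E = d) :
    HasHoffmanBound E := by
  induction d generalizing E with
  | zero =>
    have := Module.finrank_zero_iff.1 hd
    intro ι _ a
    refine ⟨0, le_rfl, fun v ρ _ _ => ⟨v, fun i => ?_, by simp⟩⟩
    rw [Subsingleton.elim v 0, map_zero]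
  | succ d ih =>
    exact (ih (Es d) (by simp)).prod_real.of_equiv
      (ContinuousLinearEquiv.ofFinrankEq (by simp [hd]))

theorem HasHoffmanBound.eventually_exists_mem_polyhedron {E : Type*} [NormedAddCommGroup E]
    [NormedSpace ℝ E] (hE : HasHoffmanBound E) {m : ℕ} {C : Set E} (hC : IsPolyhedron C)
    (L : E →L[ℝ] Es m) (zb : E) :
    ∃ κ : ℝ, 0 ≤ κ ∧ ∀ᶠ z in 𝓝 zb, z ∈ C →
      ∃ z' ∈ C, L z' = L zb ∧ ‖z - z'‖ ≤ κ * ‖L z - L zb‖ := by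
  classical
  obtain ⟨k, f, c, rfl⟩ := hC
  by_cases hzb : zb ∈ {z | ∀ i, f i z ≤ c i}
  swap
  · have hcl : IsClosed {z | ∀ i, f i z ≤ c i} := by
      simp only [ofPred_forall]
      exact isClosed_iInter fun i => isClosed_le (f i).continuous continuous_const
    refine ⟨0, le_rfl, ?_⟩
    filter_upwards [hcl.isOpen_compl.mem_nhds hzb] with z hz hz'
    exact absurd hz' hz
  let coord : Fin m → (E →L[ℝ] ℝ) := fun i => (EuclideanSpace.proj i).comp L
  let a : Fin k ⊕ (Fin m ⊕ Fin m) → (E →L[ℝ] ℝ) :=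
    Sum.elim (fun i => if f i zb = c i then f i else 0) (Sum.elim coord fun i => -coord i)
  obtain ⟨κ, hκ, h⟩ := hE _ a
  refine ⟨κ, hκ, ?_⟩
  have hinact : ∀ᶠ z in 𝓝 zb, ∀ i, f i zb < c i → f i z < c i := by
    rw [eventually_all]
    intro i
    by_cases hi : f i zb < c i
    · filter_upwards [(f i).continuous.continuousAt.eventually_lt_const hi] with z hz _ using hz
    · exact Eventually.of_forall fun z hz => absurd hz hi
  obtain ⟨δ, hδ, hball⟩ := Metric.eventually_nhds_iff.1 hinact
  have hB : 0 < 1 + κ * ‖L‖ := by positivity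
  filter_upwards [Metric.ball_mem_nhds zb (div_pos hδ hB)] with z hz hzC
  rw [mem_ball, dist_eq_norm, lt_div_iff₀ hB] at hz
  obtain ⟨v', hv', hd⟩ := h (z - zb) ‖L (z - zb)‖ (norm_nonneg _) (by
    rintro (i | i | i)
    · simp only [a, Sum.elim_inl]
      split_ifs with hi
      · rw [map_sub, hi]
        have := hzC i
        have := norm_nonneg (L (z - zb))
        linarith
      · simp
    · exact (le_abs_self _).trans (PiLp.norm_apply_le (L (z - zb)) i)
    · exact (neg_le_abs _).trans (PiLp.norm_apply_le (L (z - zb)) i))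
  have hLv : L v' = 0 := by
    ext i
    have h1 : coord i v' ≤ 0 := hv' (Sum.inr (Sum.inl i))
    have h2 : -coord i v' ≤ 0 := hv' (Sum.inr (Sum.inr i))
    exact le_antisymm h1 (neg_nonpos.1 h2)
  refine ⟨zb + v', fun i => ?_, by rw [map_add, hLv, add_zero], ?_⟩
  · rcases (hzb i).lt_or_eq with hi | hi
    · refine (hball ?_ i hi).le
      rw [dist_eq_norm, add_sub_cancel_left]
      calc ‖v'‖ ≤ ‖z - zb‖ + ‖z - zb - v'‖ := by
            rw [norm_sub_rev (z - zb) v']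
            exact norm_le_norm_add_norm_sub' v' (z - zb)
        _ ≤ ‖z - zb‖ + κ * (‖L‖ * ‖z - zb‖) := by
            gcongr
            exact hd.trans (by gcongr; exact L.le_opNorm _)
        _ = ‖z - zb‖ * (1 + κ * ‖L‖) := by ring
        _ < δ := hz
    · have := hv' (Sum.inl i)
      simp only [a, Sum.elim_inl, hi, if_true] at this
      rw [map_add, hi]
      linarith
  · rwa [← map_sub, ← sub_sub]

theorem eventually_exists_mem_iUnion_polyhedron {E : Type} [NormedAddCommGroup E]
    [NormedSpace ℝ E] [FiniteDimensional ℝ E] {m N : ℕ} {C : Fin N → Set E}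
    (hC : ∀ j, IsPolyhedron (C j)) (L : E →L[ℝ] Es m) (zb : E) :
    ∃ κ : ℝ, 0 ≤ κ ∧ ∀ᶠ z in 𝓝 zb, z ∈ ⋃ j, C j →
      ∃ z' ∈ ⋃ j, C j, L z' = L zb ∧ ‖z - z'‖ ≤ κ * ‖L z - L zb‖ := by
  choose κ hκ h using fun j =>
    (hasHoffmanBound_of_finrank_eq _ E rfl).eventually_exists_mem_polyhedron (hC j) L zb
  refine ⟨∑ j, κ j, Finset.sum_nonneg fun j _ => hκ j, ?_⟩
  filter_upwards [eventually_all.2 h] with z hz hzC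
  obtain ⟨j, hj⟩ := mem_iUnion.1 hzC
  obtain ⟨z', hz', hL, hd⟩ := hz j hj
  refine ⟨z', mem_iUnion.2 ⟨j, hz'⟩, hL, hd.trans ?_⟩
  gcongr
  exact Finset.single_le_sum (fun j _ => hκ j) (Finset.mem_univ j)

/-- The solution map of `0 ∈ A(p)x + b(p) + Q(x)` with `A`, `b` Lipschitz near `pb` and
`Q` polyhedral is calm at every reference point of its graph. -/
theorem stmt2 {l n m : ℕ}
    (A : Es l → (Es n →L[ℝ] Es m)) (b : Es l → Es m) (Q : Es n → Set (Es m))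
    (pb : Es l) (xb : Es n)
    (hA : ∃ U ∈ 𝓝 pb, ∃ c : NNReal, LipschitzOnWith c A U)
    (hb : ∃ U ∈ 𝓝 pb, ∃ c : NNReal, LipschitzOnWith c b U)
    (hQ : ∃ (N : ℕ) (C : Fin N → Set (Es n × Es m)), (∀ j, IsPolyhedron (C j)) ∧
      {z : Es n × Es m | z.2 ∈ Q z.1} = ⋃ j, C j)
    (hbar : ∃ w ∈ Q xb, A pb xb + b pb + w = 0) :
    CalmAt (fun p => {x | ∃ w ∈ Q x, A p x + b p + w = 0}) pb xb := by
  obtain ⟨UA, hUA, cA, hA⟩ := hA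
  obtain ⟨Ub, hUb, cb, hb⟩ := hb
  obtain ⟨N, C, hC, hgph⟩ := hQ
  obtain ⟨wb, hwb, hzero⟩ := hbar
  have hmem : ∀ x w, w ∈ Q x ↔ (x, w) ∈ ⋃ j, C j := fun x w => by rw [← hgph]; rfl
  let L : Es n × Es m →L[ℝ] Es m :=
    (A pb).comp (ContinuousLinearMap.fst ℝ _ _) + ContinuousLinearMap.snd ℝ _ _
  have hLapp : ∀ x w, L (x, w) = A pb x + w := fun x w => rfl
  have hLb : L (xb, wb) = -b pb := by
    rw [hLapp, eq_neg_iff_add_eq_zero, ← hzero]; abel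
  obtain ⟨κ, hκ, hev⟩ := eventually_exists_mem_iUnion_polyhedron hC L (xb, wb)
  have hAc : ContinuousAt A pb := hA.continuousOn.continuousAt hUA
  have hbc : ContinuousAt b pb := hb.continuousOn.continuousAt hUb
  have hcont : Tendsto (fun q : Es l × Es n => (q.2, -(A q.1 q.2 + b q.1)))
      (𝓝 (pb, xb)) (𝓝 (xb, wb)) := by
    have hw : wb = -(A pb xb + b pb) := by
      rw [eq_neg_iff_add_eq_zero, ← hzero]; abel
    have hA' : ContinuousAt (fun q : Es l × Es n => A q.1) (pb, xb) :=
      ContinuousAt.comp (f := Prod.fst) hAc continuousAt_fst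
    have hb' : ContinuousAt (fun q : Es l × Es n => b q.1) (pb, xb) :=
      ContinuousAt.comp (f := Prod.fst) hbc continuousAt_fst
    rw [hw]
    exact continuousAt_snd.prodMk ((hA'.clm_apply continuousAt_snd).add hb').neg
  have hnorm : ∀ᶠ q : Es l × Es n in 𝓝 (pb, xb), ‖q.2‖ < ‖xb‖ + 1 :=
    (continuous_snd.norm.continuousAt (x := ((pb, xb) : Es l × Es n))).eventually_lt_const
      (lt_add_one ‖xb‖)
  have hfst : Tendsto Prod.fst (𝓝 ((pb, xb) : Es l × Es n)) (𝓝 pb) := continuousAt_fst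
  obtain ⟨ε, hε, hall⟩ := Metric.eventually_nhds_iff.1
    ((hcont.eventually hev).and (hnorm.and ((hfst.eventually hUA).and (hfst.eventually hUb))))
  refine ⟨κ * (cA * (‖xb‖ + 1) + cb), by positivity, ε, hε, ?_⟩
  rintro p x hp hx ⟨w, hw, hpx⟩
  obtain ⟨hz, hxn, hpA, hpb⟩ := hall (y := (p, x)) (by rw [Prod.dist_eq]; exact max_lt hp hx)
  have hw' : -(A p x + b p) = w := by
    rw [neg_eq_iff_add_eq_zero, hpx]
  simp only [hw', hLb] at hz
  obtain ⟨⟨x', w'⟩, hz'C, hz'L, hd⟩ := hz ((hmem x w).1 hw)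
  have hx' : x' ∈ {x | ∃ w ∈ Q x, A pb x + b pb + w = 0} := by
    refine ⟨w', (hmem _ _).2 hz'C, ?_⟩
    rw [hLapp] at hz'L
    rw [add_right_comm, hz'L, neg_add_cancel]
  have hres : ‖L (x, w) - -b pb‖ ≤ (cA * (‖xb‖ + 1) + cb) * dist p pb := by
    have heq : L (x, w) - -b pb = (A pb - A p) x + (b pb - b p) := by
      rw [hLapp, ← hw', sub_apply]; abel
    have h1 : ‖A pb - A p‖ ≤ cA * dist p pb := by
      rw [← dist_eq_norm, dist_comm p]
      exact hA.dist_le_mul _ (mem_of_mem_nhds hUA) _ hpA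
    have h2 : ‖b pb - b p‖ ≤ cb * dist p pb := by
      rw [← dist_eq_norm, dist_comm p]
      exact hb.dist_le_mul _ (mem_of_mem_nhds hUb) _ hpb
    calc ‖L (x, w) - -b pb‖ ≤ ‖A pb - A p‖ * ‖x‖ + ‖b pb - b p‖ := by
          rw [heq]
          exact (norm_add_le _ _).trans (by gcongr; exact ContinuousLinearMap.le_opNorm _ _)
      _ ≤ (cA * dist p pb) * (‖xb‖ + 1) + cb * dist p pb := by gcongr
      _ = _ := by ring
  calc infDist x {x | ∃ w ∈ Q x, A pb x + b pb + w = 0} ≤ dist x x' := infDist_le_dist_of_mem hx'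
    _ ≤ ‖(x, w) - (x', w')‖ := by
        rw [dist_eq_norm]
        exact le_max_left _ _
    _ ≤ κ * ‖L (x, w) - -b pb‖ := hd
    _ ≤ κ * ((cA * (‖xb‖ + 1) + cb) * dist p pb) := by gcongr
    _ = _ := by ring
end
end

section
/- Let M(p,x) = G(p,x) − D with D ⊆ ℝᵐ closed, G : ℝˡ × ℝⁿ → ℝᵐ, (p̄,x̄) with G(p̄,x̄) ∈ D, let S(p) := {x : 0 ∈ M(p,x)}, assume G(p̄,·) is strictly differentiable at x̄, and assume there are neighborhoods W of p̄, U of x̄ and L' ≥ 0 with ‖G(p,x) − G(p̄,x)‖ ≤ L'‖p − p̄‖ for all (p,x) ∈ W × U. If there do not exist u ≠ 0 in ℝⁿ and v* ≠ 0 in ℝᵐ with ∇ₓG(p̄,x̄)u ∈ T_D(G(p̄,x̄)), ∇ₓG(p̄,x̄)ᵀv* = 0, and v* ∈ N_D(G(p̄,x̄); ∇ₓG(p̄,x̄)u), then S is calm at (p̄,x̄). If in addition G is partially differentiable with respect to x on W × U, ∇ₓG is continuous at (p̄,x̄), for every p ∈ W the map ∇ₓG(p,·) is continuous on U, and there exists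 ũ with ‖ũ‖ = 1 such that ∇ₓG(p̄,x̄)ũ ∈ T_D(G(p̄,x̄)) and the tangent ∇ₓG(p̄,x̄)ũ is derivable, then there exist a neighborhood W̃ of p̄ and L̃ ≥ 0 such that S(p) ≠ ∅ and dist(x̄, S(p)) ≤ L̃‖p − p̄‖ for all p ∈ W̃. -/
open Filter Topology Metric Set
open scoped RealInnerProductSpace

noncomputable section

/-- The tangent (contingent) cone to `A` at `x`. -/
def tcone {E : Type*} [NormedAddCommGroup E] [NormedSpace ℝ E] (A : Set E) (x : E) : Set E :=
  {w | ∃ t : ℕ → ℝ, ∃ w' : ℕ → E,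
    (∀ k, 0 < t k) ∧ Tendsto t atTop (𝓝 0) ∧ Tendsto w' atTop (𝓝 w) ∧
    ∀ k, x + t k • w' k ∈ A}

/-- The regular (Fréchet) normal cone to `A` at `x`; it is empty (by convention)
when `x ∉ A`. -/
def rnc1 {E : Type*} [NormedAddCommGroup E] [InnerProductSpace ℝ E] (A : Set E) (x : E) :
    Set E :=
  {xs | x ∈ A ∧ ∀ w ∈ tcone A x, ⟪xs, w⟫ ≤ 0}

/-- The directional limiting normal cone to `A` at `x` in direction `w`. -/
def dnc1 {E : Type*} [NormedAddCommGroup E] [InnerProductSpace ℝ E] (A : Set E) (x w : E) :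
    Set E :=
  {xs | ∃ t : ℕ → ℝ, ∃ w' : ℕ → E, ∃ xs' : ℕ → E,
    (∀ k, 0 < t k) ∧ Tendsto t atTop (𝓝 0) ∧ Tendsto w' atTop (𝓝 w) ∧
    Tendsto xs' atTop (𝓝 xs) ∧ ∀ k, xs' k ∈ rnc1 A (x + t k • w' k)}

theorem sub_mem_rnc1_of_forall_norm_le {E : Type*} [NormedAddCommGroup E] [InnerProductSpace ℝ E]
    {D : Set E} {y z : E} (hy : y ∈ D) (hmin : ∀ y' ∈ D, ‖z - y‖ ≤ ‖z - y'‖) :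
    z - y ∈ rnc1 D y := by
  refine ⟨hy, ?_⟩
  rintro w ⟨t, w', ht, ht0, hw, hmem⟩
  have hle : ∀ k, ⟪z - y, w' k⟫ ≤ t k / 2 * ‖w' k‖ ^ 2 := by
    intro k
    have h1 := hmin _ (hmem k)
    have h2 : ‖z - y‖ ^ 2 ≤ ‖(z - y) - t k • w' k‖ ^ 2 := by
      rw [sub_sub]
      gcongr
    rw [norm_sub_sq_real (z - y), real_inner_smul_right, norm_smul, mul_pow, Real.norm_eq_abs,
      sq_abs] at h2
    have h3 : 0 ≤ t k * (t k / 2 * ‖w' k‖ ^ 2 - ⟪z - y, w' k⟫) := by nlinarith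
    linarith [nonneg_of_mul_nonneg_right h3 (ht k)]
  have h1 : Tendsto (fun k => ⟪z - y, w' k⟫) atTop (𝓝 ⟪z - y, w⟫) :=
    tendsto_const_nhds.inner hw
  have h2 : Tendsto (fun k => t k / 2 * ‖w' k‖ ^ 2) atTop (𝓝 (0 / 2 * ‖w‖ ^ 2)) :=
    (ht0.div_const 2).mul (hw.norm.pow 2)
  simpa using le_of_tendsto_of_tendsto' h1 h2 hle

theorem smul_mem_rnc1 {E : Type*} [NormedAddCommGroup E] [InnerProductSpace ℝ E]
    {D : Set E} {y v : E} {a : ℝ} (ha : 0 ≤ a) (hv : v ∈ rnc1 D y) : a • v ∈ rnc1 D y := by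
  refine ⟨hv.1, fun w hw => ?_⟩
  rw [real_inner_smul_left]
  exact mul_nonpos_of_nonneg_of_nonpos ha (hv.2 w hw)

theorem norm_adjoint_le_of_eventually_norm_le {E F : Type*} [NormedAddCommGroup E]
    [InnerProductSpace ℝ E] [CompleteSpace E] [NormedAddCommGroup F] [InnerProductSpace ℝ F]
    [CompleteSpace F] {A : E →L[ℝ] F} {z : F} {c : ℝ} (hc : 0 ≤ c)
    (hmin : ∀ᶠ h in 𝓝 (0 : E), ‖z‖ ≤ ‖z + A h‖ + c * ‖h‖) :
    ‖ContinuousLinearMap.adjoint A z‖ ≤ c * ‖z‖ := by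
  rcases eq_or_ne z 0 with rfl | hz
  · simp
  set a := ContinuousLinearMap.adjoint A z with ha
  have hinner : ⟪z, A a⟫ = ‖a‖ ^ 2 := by
    rw [← ContinuousLinearMap.adjoint_inner_left, ← ha, real_inner_self_eq_norm_sq]
  have hlim : Tendsto (fun t : ℝ => t • (-a)) (𝓝[>] 0) (𝓝 0) := by
    have : Tendsto (fun t : ℝ => t • (-a)) (𝓝 0) (𝓝 ((0 : ℝ) • (-a))) :=
      tendsto_id.smul_const _
    rw [zero_smul] at this
    exact this.mono_left nhdsWithin_le_nhds
  have hsmall : ∀ᶠ t : ℝ in 𝓝[>] 0, c * t * ‖a‖ < ‖z‖ := by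
    have : Tendsto (fun t : ℝ => c * t * ‖a‖) (𝓝 0) (𝓝 (c * 0 * ‖a‖)) :=
      (tendsto_id.const_mul c).mul_const _
    refine (this.mono_left nhdsWithin_le_nhds).eventually_lt_const ?_
    simpa using hz
  have hineq : ∀ᶠ t : ℝ in 𝓝[>] 0, 2 * ‖a‖ ^ 2 ≤ 2 * c * ‖a‖ * ‖z‖ + t * ‖A a‖ ^ 2 := by
    filter_upwards [hlim.eventually hmin, hsmall, self_mem_nhdsWithin] with t h1 h2 (ht : 0 < t)
    have h3 : ‖z‖ - c * t * ‖a‖ ≤ ‖z - t • A a‖ := by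
      rw [norm_smul, norm_neg, Real.norm_of_nonneg ht.le, smul_neg, map_neg, map_smul,
        ← sub_eq_add_neg] at h1
      linarith
    have h4 : (‖z‖ - c * t * ‖a‖) ^ 2 ≤ ‖z - t • A a‖ ^ 2 := by
      have : 0 ≤ ‖z‖ - c * t * ‖a‖ := by linarith
      gcongr
    rw [norm_sub_sq_real, real_inner_smul_right, hinner, norm_smul, Real.norm_of_nonneg ht.le] at h4
    have h5 : 0 ≤ t * (2 * c * ‖a‖ * ‖z‖ + t * ‖A a‖ ^ 2 - 2 * ‖a‖ ^ 2) := by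
      nlinarith [sq_nonneg (c * t * ‖a‖)]
    linarith [nonneg_of_mul_nonneg_right h5 ht]
  have hlim2 : Tendsto (fun t : ℝ => 2 * c * ‖a‖ * ‖z‖ + t * ‖A a‖ ^ 2) (𝓝[>] 0)
      (𝓝 (2 * c * ‖a‖ * ‖z‖ + 0 * ‖A a‖ ^ 2)) :=
    ((tendsto_id.mul_const _).const_add _).mono_left nhdsWithin_le_nhds
  have hfin := ge_of_tendsto hlim2 hineq
  rcases (norm_nonneg a).eq_or_lt with h0 | h0
  · rw [← h0]; positivity
  · have : 0 ≤ ‖a‖ * (c * ‖z‖ - ‖a‖) := by nlinarith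
    linarith [nonneg_of_mul_nonneg_right this h0]

/-- Either `g` hits `D` near `x₀`, or an almost critical point for the distance to `D` exists. -/
theorem exists_almost_critical {E F : Type*} [NormedAddCommGroup E] [InnerProductSpace ℝ E]
    [ProperSpace E] [NormedAddCommGroup F] [InnerProductSpace ℝ F] [ProperSpace F]
    {A : E →L[ℝ] F} {g : E → F} {D : Set F} (hD : IsClosed D) (hne : D.Nonempty)
    {x₀ : E} {r c ε : ℝ} (hr : 0 < r) (hc : 0 < c) (hε : 0 ≤ ε)
    (happrox : ∀ x ∈ closedBall x₀ r, ∀ x' ∈ closedBall x₀ r,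
      ‖g x - g x' - A (x - x')‖ ≤ ε * ‖x - x'‖)
    (hlt : infDist (g x₀) D < c * r) (hdisj : ∀ x ∈ closedBall x₀ r, g x ∉ D) :
    ∃ x ∈ closedBall x₀ r, ∃ y ∈ D, ∃ v ∈ rnc1 D y, ‖v‖ = 1 ∧
      ‖ContinuousLinearMap.adjoint A v‖ ≤ c + ε ∧ ‖g x - y‖ ≤ c * r := by
  have hcont : ContinuousOn g (closedBall x₀ r) := by
    refine (LipschitzOnWith.of_dist_le_mul (K := ‖A‖₊ + ε.toNNReal) ?_).continuousOn
    intro x hx x' hx'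
    rw [dist_eq_norm, dist_eq_norm]
    have h1 := happrox x hx x' hx'
    have h2 := A.le_opNorm (x - x')
    have h3 := norm_add_le (g x - g x' - A (x - x')) (A (x - x'))
    rw [sub_add_cancel] at h3
    push_cast
    rw [Real.coe_toNNReal _ hε]
    linarith
  obtain ⟨x, hx, hxmin⟩ := (isCompact_closedBall x₀ r).exists_isMinOn
    ⟨x₀, mem_closedBall_self hr.le⟩
    (f := fun x => infDist (g x) D + c * ‖x - x₀‖)
    (((continuous_infDist_pt D).comp_continuousOn hcont).add
      (Continuous.continuousOn (by fun_prop)))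
  rw [isMinOn_iff] at hxmin
  obtain ⟨y, hy, hxy⟩ := hD.exists_infDist_eq_dist hne (g x)
  have hval := hxmin x₀ (mem_closedBall_self hr.le)
  simp only [sub_self, norm_zero, mul_zero, add_zero] at hval
  have hxr : ‖x - x₀‖ < r := by
    have : c * ‖x - x₀‖ < c * r := by linarith [infDist_nonneg (x := g x) (s := D)]
    exact lt_of_mul_lt_mul_left this hc.le
  have hz : g x - y ≠ 0 := fun h => hdisj x hx (by rwa [sub_eq_zero.1 h])
  have hzn : 0 < ‖g x - y‖ := norm_pos_iff.2 hz
  rw [dist_eq_norm] at hxy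
  have hprox : g x - y ∈ rnc1 D y := by
    refine sub_mem_rnc1_of_forall_norm_le hy fun y' hy' => ?_
    rw [← hxy, ← dist_eq_norm]
    exact infDist_le_dist_of_mem hy'
  have hadj : ‖ContinuousLinearMap.adjoint A (g x - y)‖ ≤ (c + ε) * ‖g x - y‖ := by
    refine norm_adjoint_le_of_eventually_norm_le (by positivity) ?_
    filter_upwards [ball_mem_nhds (0 : E) (sub_pos.2 hxr)] with h hh
    rw [mem_ball_zero_iff] at hh
    have hxh : x + h ∈ closedBall x₀ r := by
      rw [mem_closedBall, dist_eq_norm, add_sub_right_comm]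
      linarith [norm_add_le (x - x₀) h]
    have h1 := hxmin _ hxh
    have h2 := happrox _ hxh x hx
    rw [add_sub_cancel_left] at h2
    have h3 : infDist (g (x + h)) D ≤ ‖g (x + h) - y‖ := by
      rw [← dist_eq_norm]
      exact infDist_le_dist_of_mem hy
    have h4 : ‖g (x + h) - y‖ ≤ ‖g (x + h) - g x - A h‖ + ‖g x - y + A h‖ := by
      have := norm_add_le (g (x + h) - g x - A h) (g x - y + A h)
      rwa [show g (x + h) - g x - A h + (g x - y + A h) = g (x + h) - y by abel] at this
    have h5 : ‖x + h - x₀‖ ≤ ‖x - x₀‖ + ‖h‖ := by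
      rw [add_sub_right_comm]
      exact norm_add_le _ _
    have h6 := mul_le_mul_of_nonneg_left h5 hc.le
    linarith
  refine ⟨x, hx, y, hy, ‖g x - y‖⁻¹ • (g x - y), smul_mem_rnc1 (by positivity) hprox,
    ?_, ?_, ?_⟩
  · rw [norm_smul, norm_inv, norm_norm, inv_mul_cancel₀ hzn.ne']
  · rw [map_smul, norm_smul, norm_inv, norm_norm, inv_mul_le_iff₀ hzn, mul_comm]
    exact hadj
  · have : 0 ≤ c * ‖x - x₀‖ := by positivity
    linarith

theorem exists_gap_of_not_exists_critical {E F : Type*} [NormedAddCommGroup E]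
    [InnerProductSpace ℝ E] [ProperSpace E] [NormedAddCommGroup F] [InnerProductSpace ℝ F]
    [ProperSpace F] {A : E →L[ℝ] F} {D : Set F} {yb : F} {xb : E}
    (hcond : ¬ ∃ (u : E) (vs : F), u ≠ 0 ∧ vs ≠ 0 ∧
      A u ∈ tcone D yb ∧ ContinuousLinearMap.adjoint A vs = 0 ∧ vs ∈ dnc1 D yb (A u)) :
    ∃ δ > 0, ∀ x, x ≠ xb → ‖x - xb‖ < δ → ∀ y ∈ D, ∀ v ∈ rnc1 D y, ‖v‖ = 1 →
      ‖ContinuousLinearMap.adjoint A v‖ ≤ δ → δ * ‖x - xb‖ < ‖y - yb - A (x - xb)‖ := by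
  by_contra! hcon
  have hpos : ∀ k : ℕ, (0 : ℝ) < 1 / ((k : ℝ) + 1) := fun k => by positivity
  have hlim0 : Tendsto (fun k : ℕ => 1 / ((k : ℝ) + 1)) atTop (𝓝 0) :=
    tendsto_one_div_add_atTop_nhds_zero_nat
  choose x hx hxlt y hy v hv hv1 hAv hxy using fun k => hcon _ (hpos k)
  have ht : ∀ k, 0 < ‖x k - xb‖ := fun k => norm_pos_iff.2 (sub_ne_zero.2 (hx k))
  set u : ℕ → E := fun k => ‖x k - xb‖⁻¹ • (x k - xb) with hu
  have hu1 : ∀ k, ‖u k‖ = 1 := fun k => by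
    rw [hu, norm_smul, norm_inv, norm_norm, inv_mul_cancel₀ (ht k).ne']
  obtain ⟨⟨u₀, v₀⟩, huv₀, φ, hφ, hφlim⟩ :=
    ((isCompact_sphere (0 : E) 1).prod (isCompact_sphere (0 : F) 1)).tendsto_subseq
      (x := fun k => (u k, v k)) fun k => by simp [hu1 k, hv1 k]
  have hφu : Tendsto (u ∘ φ) atTop (𝓝 u₀) := (continuous_fst.tendsto _).comp hφlim
  have hφv : Tendsto (v ∘ φ) atTop (𝓝 v₀) := (continuous_snd.tendsto _).comp hφlim
  have htlim : Tendsto (fun k => ‖x k - xb‖) atTop (𝓝 0) :=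
    squeeze_zero (fun k => norm_nonneg _) (fun k => (hxlt k).le) hlim0
  set w : ℕ → F := fun k => ‖x k - xb‖⁻¹ • (y k - yb) with hw
  have hyw : ∀ k, yb + ‖x k - xb‖ • w k = y k := fun k => by
    rw [hw, smul_inv_smul₀ (ht k).ne', add_sub_cancel]
  have hwu : Tendsto (fun k => w k - A (u k)) atTop (𝓝 0) := by
    refine squeeze_zero_norm (fun k => ?_) hlim0
    rw [hw, hu, map_smul, ← smul_sub, norm_smul, norm_inv, norm_norm, inv_mul_le_iff₀ (ht k),
      mul_comm]
    exact hxy k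
  have hwlim : Tendsto (w ∘ φ) atTop (𝓝 (A u₀)) := by
    have := (hwu.comp hφ.tendsto_atTop).add ((A.continuous.tendsto u₀).comp hφu)
    simpa [Function.comp_def] using this
  have hAv0 : ContinuousLinearMap.adjoint A v₀ = 0 := by
    refine tendsto_nhds_unique
      (((ContinuousLinearMap.adjoint A).continuous.tendsto v₀).comp hφv) ?_
    exact squeeze_zero_norm (fun k => hAv (φ k)) (hlim0.comp hφ.tendsto_atTop)
  simp only [mem_prod, mem_sphere_zero_iff_norm] at huv₀
  refine hcond ⟨u₀, v₀, ?_, ?_, ?_, hAv0, ?_⟩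
  · rintro rfl; simp at huv₀
  · rintro rfl; simp at huv₀
  · refine ⟨fun k => ‖x (φ k) - xb‖, w ∘ φ, fun k => ht _, htlim.comp hφ.tendsto_atTop, hwlim,
      fun k => ?_⟩
    simpa only [Function.comp_apply, hyw] using hy (φ k)
  · refine ⟨fun k => ‖x (φ k) - xb‖, w ∘ φ, v ∘ φ, fun k => ht _, htlim.comp hφ.tendsto_atTop,
      hwlim, hφv, fun k => ?_⟩
    simpa only [Function.comp_apply, hyw] using hv (φ k)

theorem exists_forall_exists_mem_closedBall {E F : Type*} [NormedAddCommGroup E]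
    [InnerProductSpace ℝ E] [ProperSpace E] [NormedAddCommGroup F] [InnerProductSpace ℝ F]
    [ProperSpace F] {A : E →L[ℝ] F} {D : Set F} (hD : IsClosed D) {yb : F} (hyb : yb ∈ D) {xb : E}
    (hcond : ¬ ∃ (u : E) (vs : F), u ≠ 0 ∧ vs ≠ 0 ∧
      A u ∈ tcone D yb ∧ ContinuousLinearMap.adjoint A vs = 0 ∧ vs ∈ dnc1 D yb (A u)) :
    ∃ η > 0, ∀ (g : E → F) (x₀ : E) (r : ℝ), 0 < r →
      (∀ x ∈ closedBall x₀ r, r ≤ ‖x - xb‖ ∧ ‖x - xb‖ < η ∧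
        ‖g x - yb - A (x - xb)‖ ≤ η * ‖x - xb‖) →
      (∀ x ∈ closedBall x₀ r, ∀ x' ∈ closedBall x₀ r,
        ‖g x - g x' - A (x - x')‖ ≤ η * ‖x - x'‖) →
      infDist (g x₀) D < η * r → ∃ x ∈ closedBall x₀ r, g x ∈ D := by
  obtain ⟨δ, hδ, hgap⟩ := exists_gap_of_not_exists_critical (xb := xb) hcond
  refine ⟨δ / 2, half_pos hδ, fun g x₀ r hr hnear happrox hlt => ?_⟩
  by_contra! hdisj
  obtain ⟨x, hx, y, hy, v, hv, hv1, hAv, hxy⟩ :=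
    exists_almost_critical hD ⟨yb, hyb⟩ hr (half_pos hδ) (half_pos hδ).le happrox hlt hdisj
  obtain ⟨h1, h2, h3⟩ := hnear x hx
  have hxne : x ≠ xb := by
    rintro rfl
    rw [sub_self, norm_zero] at h1
    linarith
  have h4 := hgap x hxne (by linarith) y hy v hv hv1 (by linarith)
  have h5 : ‖y - yb - A (x - xb)‖ ≤ ‖g x - y‖ + ‖g x - yb - A (x - xb)‖ := by
    rw [← norm_neg (g x - y)]
    have := norm_add_le (-(g x - y)) (g x - yb - A (x - xb))
    rwa [show -(g x - y) + (g x - yb - A (x - xb)) = y - yb - A (x - xb) by abel] at this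
  have h6 := mul_le_mul_of_nonneg_left h1 (half_pos hδ).le
  linarith

/-- First-order conditions for calmness and local nonemptiness of the solution map of the
parameterized constraint system `0 ∈ G(p,x) - D` (Theorem `ThClmConstrSystFO`). -/
theorem stmt5 {l n m : ℕ} (G : Es l × Es n → Es m) (D : Set (Es m)) (pb : Es l) (xb : Es n)
    (hD : IsClosed D) (hbar : G (pb, xb) ∈ D)
    (A : Es n →L[ℝ] Es m) (hA : HasStrictFDerivAt (fun x => G (pb, x)) A xb)
    (W : Set (Es l)) (U : Set (Es n)) (hW : W ∈ 𝓝 pb) (hU : U ∈ 𝓝 xb)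
    (L' : ℝ) (hL'0 : 0 ≤ L')
    (hLip : ∀ p ∈ W, ∀ x ∈ U, ‖G (p, x) - G (pb, x)‖ ≤ L' * ‖p - pb‖)
    (hcond : ¬ ∃ (u : Es n) (vs : Es m), u ≠ 0 ∧ vs ≠ 0 ∧
      A u ∈ tcone D (G (pb, xb)) ∧ ContinuousLinearMap.adjoint A vs = 0 ∧
      vs ∈ dnc1 D (G (pb, xb)) (A u)) :
    CalmAt (fun p => {x | G (p, x) ∈ D}) pb xb ∧
    (∀ Gx : Es l × Es n → (Es n →L[ℝ] Es m),
      (∀ p ∈ W, ∀ x ∈ U, HasFDerivAt (fun x' => G (p, x')) (Gx (p, x)) x) →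
      ContinuousAt Gx (pb, xb) →
      (∀ p ∈ W, ContinuousOn (fun x => Gx (p, x)) U) →
      (∃ ut : Es n, ‖ut‖ = 1 ∧ A ut ∈ tcone D (G (pb, xb)) ∧
        ∃ ε : ℝ, 0 < ε ∧ ∃ ξ : ℝ → Es m, ξ 0 = G (pb, xb) ∧ (∀ t ∈ Icc (0:ℝ) ε, ξ t ∈ D) ∧
          Tendsto (fun t : ℝ => t⁻¹ • (ξ t - (G (pb, xb) + t • A ut))) (𝓝[>] 0) (𝓝 0)) →
      ∃ Wt ∈ 𝓝 pb, ∃ Lt : ℝ, 0 ≤ Lt ∧ ∀ p ∈ Wt,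
        {x | G (p, x) ∈ D}.Nonempty ∧ infDist xb {x | G (p, x) ∈ D} ≤ Lt * ‖p - pb‖) := by
  obtain ⟨η, hη, hmain⟩ := exists_forall_exists_mem_closedBall hD hbar hcond
  refine ⟨?_, ?_⟩
  · obtain ⟨s, hs, happ⟩ := hA.approximates_deriv_on_nhds (c := ⟨η, hη.le⟩) (Or.inr hη)
    obtain ⟨ρ, hρ, hρs⟩ := Metric.mem_nhds_iff.1 (inter_mem hs hU)
    obtain ⟨ρ', hρ', hρW⟩ := Metric.mem_nhds_iff.1 hW
    refine ⟨2 / η * L', by positivity, min ρ' (min ρ η / 2), by positivity, ?_⟩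
    intro p x hp hx hGx
    have hp1 : dist p pb < ρ' := hp.trans_le (min_le_left _ _)
    have hx1 : dist x xb < min ρ η / 2 := hx.trans_le (min_le_right _ _)
    have hρη1 := min_le_left ρ η
    have hρη2 := min_le_right ρ η
    rw [dist_eq_norm] at hx1
    have hxs : x ∈ ball xb ρ := by
      rw [mem_ball, dist_eq_norm]
      linarith [norm_nonneg (x - xb)]
    rcases (infDist_nonneg (x := x) (s := {x | G (pb, x) ∈ D})).eq_or_lt with h0 | h0
    · rw [← h0]; positivity
    set d := infDist x {x | G (pb, x) ∈ D} with hd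
    have hdx : d ≤ ‖x - xb‖ := by
      rw [← dist_eq_norm]
      exact infDist_le_dist_of_mem hbar
    have hclose : ∀ x' ∈ closedBall x (d / 2), d / 2 ≤ ‖x' - xb‖ ∧ ‖x' - xb‖ < min ρ η := by
      intro x' hx'
      rw [mem_closedBall, dist_eq_norm] at hx'
      have h1 := norm_sub_le_norm_sub_add_norm_sub x' x xb
      have h2 := norm_sub_le_norm_sub_add_norm_sub x x' xb
      rw [norm_sub_rev x x'] at h2
      constructor <;> linarith
    have hmem : ∀ x' ∈ closedBall x (d / 2), x' ∈ s := fun x' hx' =>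
      (hρs (by rw [mem_ball, dist_eq_norm]; linarith [(hclose x' hx').2])).1
    have hle : η * (d / 2) ≤ infDist (G (pb, x)) D := by
      by_contra! hlt
      obtain ⟨x', hx', hx'D⟩ := hmain (fun x => G (pb, x)) x (d / 2) (half_pos h0)
        (fun x' hx' => ⟨(hclose x' hx').1, by linarith [(hclose x' hx').2],
          happ x' (hmem x' hx') xb (mem_of_mem_nhds hs)⟩)
        (fun x' hx' x'' hx'' => happ x' (hmem x' hx') x'' (hmem x'' hx'')) hlt
      have h1 : d ≤ dist x x' := infDist_le_dist_of_mem hx'D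
      rw [mem_closedBall, dist_comm] at hx'
      linarith
    have hle2 : infDist (G (pb, x)) D ≤ L' * dist p pb := by
      refine (infDist_le_dist_of_mem (s := D) hGx).trans ?_
      rw [dist_comm, dist_eq_norm, dist_eq_norm]
      exact hLip p (hρW hp1) x (hρs hxs).2
    have h3 : d ≤ 2 / η * (L' * dist p pb) := by
      rw [div_mul_eq_mul_div, le_div_iff₀ hη]
      linarith
    linarith
  · rintro Gx hGx hGxc - ⟨ut, hut, -, ε, hε, ξ, -, hξD, hξ⟩
    have hGxA : Gx (pb, xb) = A :=
      (hGx pb (mem_of_mem_nhds hW) xb (mem_of_mem_nhds hU)).unique hA.hasFDerivAt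
    obtain ⟨s, hs, happ⟩ := hA.approximates_deriv_on_nhds (c := ⟨η / 8, by positivity⟩)
      (Or.inr (show 0 < η / 8 by positivity))
    have happ' : ∀ x ∈ s, ‖G (pb, x) - G (pb, xb) - A (x - xb)‖ ≤ η / 8 * ‖x - xb‖ :=
      fun x hx => happ x hx xb (mem_of_mem_nhds hs)
    have hev : ∀ᶠ q in 𝓝 pb ×ˢ 𝓝 xb, ‖Gx q - A‖ ≤ η := by
      rw [← nhds_prod_eq]
      filter_upwards [hGxc.eventually (ball_mem_nhds _ hη)] with q hq
      rw [hGxA, dist_eq_norm] at hq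
      exact hq.le
    obtain ⟨P, hP, Q, hQ, hPQ⟩ := Filter.eventually_prod_iff.1 hev
    obtain ⟨ρ, hρ, hρs⟩ := Metric.mem_nhds_iff.1 (inter_mem (inter_mem hs hU) hQ)
    have hξ' : ∀ᶠ t : ℝ in 𝓝[>] 0,
        ‖ξ t - (G (pb, xb) + t • A ut)‖ ≤ η / 8 * t := by
      have := hξ.eventually (ball_mem_nhds _ (show 0 < η / 8 by positivity))
      filter_upwards [this, self_mem_nhdsWithin] with t ht (ht0 : 0 < t)
      rw [dist_zero_right, norm_smul, norm_inv, Real.norm_of_nonneg ht0.le,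
        inv_mul_lt_iff₀ ht0] at ht
      linarith
    obtain ⟨t₀, ht₀, hξt⟩ := mem_nhdsGT_iff_exists_Ioo_subset.1 hξ'
    replace ht₀ : 0 < t₀ := ht₀
    set K : ℝ := 8 * L' / η + 1 with hK
    have hK0 : 0 < K := by positivity
    have hKL : ∀ a : ℝ, 0 < a → L' * a < η / 8 * (K * a) := by
      intro a ha
      have : η / 8 * (K * a) = L' * a + η / 8 * a := by rw [hK]; field_simp
      have : 0 < η / 8 * a := by positivity
      linarith
    set σ : ℝ := min (min ρ η / 2) (min ε t₀) with hσ
    have hσ0 : 0 < σ := by positivity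
    have hσ1 : σ ≤ min ρ η / 2 := min_le_left _ _
    have hσ2 : σ ≤ ε := (min_le_right _ _).trans (min_le_left _ _)
    have hσ3 : σ ≤ t₀ := (min_le_right _ _).trans (min_le_right _ _)
    have hρη1 := min_le_left ρ η
    have hρη2 := min_le_right ρ η
    refine ⟨W ∩ {p | P p} ∩ ball pb (σ / K),
      inter_mem (inter_mem hW hP) (ball_mem_nhds _ (by positivity)), 3 / 2 * K, by positivity, ?_⟩
    rintro p ⟨⟨hpW, hpP⟩, hpσ⟩
    rw [mem_ball, dist_eq_norm, lt_div_iff₀ hK0] at hpσ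
    suffices h : ∃ x, G (p, x) ∈ D ∧ ‖x - xb‖ ≤ 3 / 2 * K * ‖p - pb‖ by
      obtain ⟨x, hxD, hx⟩ := h
      refine ⟨⟨x, hxD⟩, (infDist_le_dist_of_mem (s := {x | G (p, x) ∈ D}) hxD).trans ?_⟩
      rwa [dist_comm, dist_eq_norm]
    rcases eq_or_ne p pb with rfl | hppb
    · exact ⟨xb, hbar, by simp⟩
    have hp0 : 0 < ‖p - pb‖ := norm_pos_iff.2 (sub_ne_zero.2 hppb)
    set τ : ℝ := K * ‖p - pb‖ with hτ
    have hτ0 : 0 < τ := by positivity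
    have hτσ : τ < σ := by rwa [hτ, mul_comm]
    have hLτ : L' * ‖p - pb‖ < η / 8 * τ := hKL _ hp0
    have hclose : ∀ x ∈ closedBall (xb + τ • ut) (τ / 2),
        τ / 2 ≤ ‖x - xb‖ ∧ ‖x - xb‖ ≤ 3 / 2 * τ := by
      intro x hx
      rw [mem_closedBall, dist_eq_norm] at hx
      have hn : ‖τ • ut‖ = τ := by rw [norm_smul, hut, mul_one, Real.norm_of_nonneg hτ0.le]
      have h1 := norm_add_le (x - (xb + τ • ut)) (τ • ut)
      have h2 := norm_sub_le (x - xb) (x - (xb + τ • ut))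
      rw [show x - (xb + τ • ut) + τ • ut = x - xb by abel] at h1
      rw [show x - xb - (x - (xb + τ • ut)) = τ • ut by abel] at h2
      constructor <;> linarith
    have hball : ∀ x ∈ closedBall (xb + τ • ut) (τ / 2), x ∈ ball xb ρ := by
      intro x hx
      rw [mem_ball, dist_eq_norm]
      linarith [(hclose x hx).2]
    have hx₀ := mem_closedBall_self (x := xb + τ • ut) (half_pos hτ0).le
    have hderiv : ∀ x ∈ closedBall (xb + τ • ut) (τ / 2),
        ‖G (p, x) - G (pb, xb) - A (x - xb)‖ ≤ L' * ‖p - pb‖ + η / 8 * ‖x - xb‖ := by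
      intro x hx
      obtain ⟨⟨hxs, hxU⟩, -⟩ := hρs (hball x hx)
      have h1 := norm_add_le (G (p, x) - G (pb, x)) (G (pb, x) - G (pb, xb) - A (x - xb))
      rw [show G (p, x) - G (pb, x) + (G (pb, x) - G (pb, xb) - A (x - xb)) =
        G (p, x) - G (pb, xb) - A (x - xb) by abel] at h1
      linarith [hLip p hpW x hxU, happ' x hxs]
    have hstrict : ∀ x ∈ closedBall (xb + τ • ut) (τ / 2),
        ∀ x' ∈ closedBall (xb + τ • ut) (τ / 2),
        ‖G (p, x) - G (p, x') - A (x - x')‖ ≤ η * ‖x - x'‖ := fun x hx x' hx' =>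
      (convex_closedBall _ _).norm_image_sub_le_of_norm_hasFDerivWithin_le'
        (f := fun y => G (p, y)) (f' := fun y => Gx (p, y))
        (fun y hy => (hGx p hpW y (hρs (hball y hy)).1.2).hasFDerivWithinAt)
        (fun y hy => hPQ hpP (hρs (hball y hy)).2) hx' hx
    obtain ⟨x, hx, hxD⟩ := hmain (fun x => G (p, x)) (xb + τ • ut) (τ / 2) (half_pos hτ0)
      (fun x hx => by
        have h1 := hclose x hx
        refine ⟨h1.1, by linarith, (hderiv x hx).trans ?_⟩
        have h2 : η * (τ / 2) ≤ η * ‖x - xb‖ := mul_le_mul_of_nonneg_left h1.1 hη.le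
        have h3 : 0 ≤ η * ‖x - xb‖ := by positivity
        linarith)
      hstrict
      (by
        have hξτ : ‖ξ τ - (G (pb, xb) + τ • A ut)‖ ≤ η / 8 * τ :=
          hξt ⟨hτ0, by linarith⟩
        have h1 : infDist (G (p, xb + τ • ut)) D ≤ ‖G (p, xb + τ • ut) - ξ τ‖ := by
          rw [← dist_eq_norm]
          exact infDist_le_dist_of_mem (hξD τ ⟨hτ0.le, by linarith⟩)
        have h2 := hderiv _ hx₀
        rw [add_sub_cancel_left, map_smul, norm_smul, hut, mul_one,
          Real.norm_of_nonneg hτ0.le] at h2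
        have h3 := norm_sub_le (G (p, xb + τ • ut) - G (pb, xb) - τ • A ut)
          (ξ τ - (G (pb, xb) + τ • A ut))
        rw [show G (p, xb + τ • ut) - G (pb, xb) - τ • A ut - (ξ τ - (G (pb, xb) + τ • A ut)) =
          G (p, xb + τ • ut) - ξ τ by abel] at h3
        have h4 : 0 < η * τ := by positivity
        linarith)
    exact ⟨x, hxD, by linarith [(hclose x hx).2]⟩
end
end

section
/- Let M(p,x) = G(p,x) − D with D ⊆ ℝᵐ a union of finitely many convex polyhedra, G : ℝˡ × ℝⁿ → ℝᵐ, G(p̄,x̄) ∈ D, let S(p) := {x : 0 ∈ M(p,x)}, assume G(p̄,·) is twice Fréchet differentiable at x̄, and assume there are neighborhoods W of p̄, U of x̄ and L' ≥ 0 with ‖G(p,x) − G(p̄,x)‖ ≤ L'‖p − p̄‖ for all (p,x) ∈ W × U. If there do not exist u ≠ 0 and v* ≠ 0 with ∇ₓG(p̄,x̄)u ∈ T_D(G(p̄,x̄)), ∇ₓG(p̄,x̄)ᵀv* = 0, v* ∈ N_D(G(p̄,x̄); ∇ₓG(p̄,x̄)u), and uᵀ∇²ₓₓ(v*ᵀG)(p̄,x̄)u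 ≥ 0, then S is calm at (p̄,x̄). If in addition G is twice partially differentiable with respect to x on W × U, G, ∇G and ∇²ₓₓG are continuous on W × U, ‖∇ₓG(p,x̄) − ∇ₓG(p̄,x̄)‖ ≤ L'‖p − p̄‖ for all p near p̄, and there exists ũ ≠ 0 with ∇ₓG(p̄,x̄)ũ ∈ T_D(G(p̄,x̄)), then there exist a neighborhood W̃ of p̄ and L̃ ≥ 0 such that S(p) ≠ ∅ and dist(x̄, S(p)) ≤ L̃‖p − p̄‖^{1/2} for all p ∈ W̃. -/
open Filter Topology Metric Set
open scoped RealInnerProductSpace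

noncomputable section

section PolyhedralGeometry

variable {F : Type*} [NormedAddCommGroup F]

lemma mem_tcone_of_eventually [NormedSpace ℝ F] {D : Set F} {y w : F}
    (h : ∀ᶠ t : ℝ in 𝓝[>] 0, y + t • w ∈ D) : w ∈ tcone D y := by
  obtain ⟨t, ht, htD⟩ := exists_seq_forall_of_frequently
    (h.and self_mem_nhdsWithin).frequently
  exact ⟨t, fun _ => w, fun k => (htD k).2, tendsto_nhds_of_tendsto_nhdsWithin ht,
    tendsto_const_nhds, fun k => (htD k).1⟩

lemma frequently_exists_of_finite {α ι : Type*} [Finite ι] {l : Filter α}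
    {p : ι → α → Prop} (h : ∃ᶠ x in l, ∃ i, p i x) : ∃ i, ∃ᶠ x in l, p i x := by
  by_contra hcon
  push Not at hcon
  exact h ((eventually_all.2 hcon).mono fun x hx ⟨i, hi⟩ => hx i hi)

lemma IsPolyhedron.isClosed [NormedSpace ℝ F] {C : Set F} (hC : IsPolyhedron C) :
    IsClosed C := by
  obtain ⟨k, f, c, rfl⟩ := hC
  simp only [ofPred_forall]
  exact isClosed_iInter fun i => isClosed_le (f i).continuous continuous_const

/-- A polyhedron contains a short segment in every direction that does not increase the active
constraints. -/
lemma eventually_add_smul_mem_of_active [NormedSpace ℝ F] {k : ℕ} {f : Fin k → F →L[ℝ] ℝ}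
    {c : Fin k → ℝ} {y w : F} (hy : ∀ i, f i y ≤ c i) (hw : ∀ i, f i y = c i → f i w ≤ 0) :
    ∀ᶠ t : ℝ in 𝓝[>] 0, ∀ i, f i (y + t • w) ≤ c i := by
  refine eventually_all.2 fun i => ?_
  rcases (hy i).eq_or_lt with h | h
  · filter_upwards [self_mem_nhdsWithin] with t ht
    have ht' : (0 : ℝ) < t := ht
    have := hw i h
    simp only [map_add, map_smul, smul_eq_mul]
    nlinarith
  · have hcont : Continuous fun t : ℝ => f i (y + t • w) := by fun_prop
    have hlim : Tendsto (fun t : ℝ => f i (y + t • w)) (𝓝[>] 0) (𝓝 (f i y)) := by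
      simpa using (hcont.tendsto 0).mono_left nhdsWithin_le_nhds
    exact (hlim.eventually_lt_const h).mono fun t ht => ht.le

lemma eventually_add_smul_mem_of_mem_tcone [NormedSpace ℝ F] {N : ℕ} {C : Fin N → Set F}
    (hC : ∀ j, IsPolyhedron (C j)) {y w : F} (hw : w ∈ tcone (⋃ j, C j) y) :
    ∀ᶠ t : ℝ in 𝓝[>] 0, y + t • w ∈ ⋃ j, C j := by
  obtain ⟨t, w', ht, htl, hwl, hmem⟩ := hw
  obtain ⟨j, hj⟩ : ∃ j, ∃ᶠ k in atTop, y + t k • w' k ∈ C j :=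
    frequently_exists_of_finite (Frequently.of_forall fun k => mem_iUnion.1 (hmem k))
  have hlim : Tendsto (fun k => y + t k • w' k) atTop (𝓝 y) := by
    simpa using tendsto_const_nhds.add (htl.smul hwl)
  have hy : y ∈ C j := (hC j).isClosed.mem_of_frequently_of_tendsto hj hlim
  obtain ⟨K, f, c, hCj⟩ := hC j
  rw [hCj] at hy hj
  have hact : ∀ i, f i y = c i → f i w ≤ 0 := fun i hi => by
    refine le_of_tendsto_of_frequently (((f i).continuous.tendsto w).comp hwl)
      (hj.mono fun k hk => ?_)
    have h1 : f i (y + t k • w' k) ≤ c i := hk i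
    simp only [map_add, map_smul, smul_eq_mul, hi] at h1
    have := ht k
    simp only [Function.comp]
    by_contra hpos
    push Not at hpos
    nlinarith [mul_pos this hpos]
  filter_upwards [eventually_add_smul_mem_of_active hy hact] with s hs
  exact mem_iUnion.2 ⟨j, by rw [hCj]; exact hs⟩

/-- For a finite union of polyhedra, limits of regular normals at points `y k → yb` are orthogonal
to `y k - yb` infinitely often. -/
lemma frequently_inner_sub_eq_zero [InnerProductSpace ℝ F] {N : ℕ} {C : Fin N → Set F}
    (hC : ∀ j, IsPolyhedron (C j)) {y v : ℕ → F} {yb vb : F}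
    (hv : ∀ k, v k ∈ rnc1 (⋃ j, C j) (y k))
    (hyl : Tendsto y atTop (𝓝 yb)) (hvl : Tendsto v atTop (𝓝 vb)) :
    ∃ᶠ k in atTop, ⟪vb, y k - yb⟫ = 0 := by
  choose K f c hCf using hC
  obtain ⟨j, hj⟩ : ∃ j, ∃ᶠ k in atTop, y k ∈ C j :=
    frequently_exists_of_finite (Frequently.of_forall fun k => mem_iUnion.1 (hv k).1)
  obtain ⟨I, hI⟩ : ∃ I : Set (Fin (K j)), ∃ᶠ k in atTop,
      y k ∈ C j ∧ {i | f j i (y k) = c j i} = I :=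
    frequently_exists_of_finite (hj.mono fun k hk => ⟨_, hk, rfl⟩)
  have hactive : ∀ i ∈ I, f j i yb = c j i := fun i hi => by
    refine isClosed_singleton.mem_of_frequently_of_tendsto (s := {c j i}) (hI.mono fun k hk => ?_)
      (((f j i).continuous.tendsto yb).comp hyl)
    have : i ∈ {i | f j i (y k) = c j i} := by rw [hk.2]; exact hi
    exact this
  have hpolar : ∀ w, (∀ i ∈ I, f j i w ≤ 0) → ⟪vb, w⟫ ≤ 0 := fun w hw => by
    refine le_of_tendsto_of_frequently (hvl.inner tendsto_const_nhds) (hI.mono fun k hk => ?_)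
    refine (hv k).2 w (mem_tcone_of_eventually ?_)
    have hyk : ∀ i, f j i (y k) ≤ c j i := by
      have := hk.1
      rw [hCf j] at this
      exact this
    filter_upwards [eventually_add_smul_mem_of_active hyk
      (fun i hi => hw i (by rw [← hk.2]; exact hi))] with s hs
    exact mem_iUnion.2 ⟨j, by rw [hCf j]; exact hs⟩
  refine hI.mono fun k hk => ?_
  have hzero : ∀ i ∈ I, f j i (y k - yb) = 0 := fun i hi => by
    have : i ∈ {i | f j i (y k) = c j i} := by rw [hk.2]; exact hi
    have h1 : f j i (y k) = c j i := this
    rw [map_sub, h1, hactive i hi, sub_self]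
  have h1 := hpolar (y k - yb) fun i hi => (hzero i hi).le
  have h2 := hpolar (-(y k - yb)) fun i hi => by rw [map_neg, hzero i hi, neg_zero]
  rw [inner_neg_right] at h2
  linarith

end PolyhedralGeometry

section Variational

variable {E F : Type*} [NormedAddCommGroup E] [InnerProductSpace ℝ E]
  [NormedAddCommGroup F] [InnerProductSpace ℝ F]

/-- Proximal normals are regular normals. -/
lemma smul_sub_mem_rnc1_of_infDist_eq {D : Set F} {z y : F} (hy : y ∈ D)
    (hz : infDist z D = dist z y) {a : ℝ} (ha : 0 ≤ a) : a • (z - y) ∈ rnc1 D y := by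
  refine ⟨hy, fun w ⟨t, w', ht, htl, hwl, hmem⟩ => ?_⟩
  rw [real_inner_smul_left]
  refine mul_nonpos_of_nonneg_of_nonpos ha ?_
  have hlim : Tendsto (fun k => 2 * ⟪z - y, w' k⟫ - t k * ‖w' k‖ ^ 2) atTop
      (𝓝 (2 * ⟪z - y, w⟫ - 0 * ‖w‖ ^ 2)) :=
    ((tendsto_const_nhds.inner hwl).const_mul 2).sub (htl.mul (hwl.norm.pow 2))
  have hle : 2 * ⟪z - y, w⟫ - 0 * ‖w‖ ^ 2 ≤ 0 := by
    refine le_of_tendsto' hlim fun k => ?_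
    have h1 : ‖z - y‖ ≤ ‖z - y - t k • w' k‖ := by
      have := infDist_le_dist_of_mem (x := z) (hmem k)
      rw [hz, dist_eq_norm, dist_eq_norm, ← sub_sub] at this
      exact this
    have h2 : ‖z - y‖ ^ 2 ≤ ‖z - y - t k • w' k‖ ^ 2 := by gcongr
    rw [norm_sub_sq_real (z - y), real_inner_smul_right, norm_smul, mul_pow, Real.norm_eq_abs,
      sq_abs] at h2
    have h3 : 0 ≤ t k * (t k * ‖w' k‖ ^ 2 - 2 * ⟪z - y, w' k⟫) := by linarith
    have := nonneg_of_mul_nonneg_right h3 (ht k)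
    linarith
  linarith

/-- A point where `‖h · - y‖ + ε ‖· - x‖` has a local minimum with nonzero residual has a small
derivative in the direction of the residual. -/
lemma inner_fderiv_ge_of_eventually {h : E → F} {h' : E →L[ℝ] F} {x : E} {y : F} {ε : ℝ}
    (hh : HasFDerivAt h h' x) (hxy : h x ≠ y)
    (hmin : ∀ᶠ z in 𝓝 x, ‖h x - y‖ ≤ ‖h z - y‖ + ε * ‖z - x‖) (w : E) :
    -(ε * ‖w‖) ≤ ⟪‖h x - y‖⁻¹ • (h x - y), h' w⟫ := by
  have hne : ‖h x - y‖ ≠ 0 := norm_ne_zero_iff.2 (sub_ne_zero.2 hxy)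
  have hline : HasDerivAt (fun s : ℝ => x + s • w) w 0 := by
    simpa using ((hasDerivAt_id (0 : ℝ)).smul_const w).const_add x
  have hcomp : HasDerivAt (fun s : ℝ => h (x + s • w) - y) (h' w) 0 := by
    have hh0 : HasFDerivAt h h' (x + (0 : ℝ) • w) := by simpa using hh
    exact (hh0.comp_hasDerivAt (0 : ℝ) hline).sub_const y
  have hnorm : HasDerivAt (fun s : ℝ => ‖h (x + s • w) - y‖)
      (⟪‖h x - y‖⁻¹ • (h x - y), h' w⟫) 0 := by
    have h1 := (hcomp.norm_sq).sqrt (by simpa using hne)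
    simp only [Real.sqrt_sq (norm_nonneg _), zero_smul, add_zero] at h1
    convert h1 using 1
    rw [real_inner_smul_left]
    field_simp
  refine ge_of_tendsto hnorm.tendsto_slope_zero_right ?_
  have hlim : Tendsto (fun s : ℝ => x + s • w) (𝓝[>] 0) (𝓝 x) := by
    simpa using hline.continuousAt.tendsto.mono_left nhdsWithin_le_nhds
  filter_upwards [hlim.eventually hmin, self_mem_nhdsWithin] with s hs hs0
  have hs0' : (0 : ℝ) < s := hs0
  simp only [zero_add, zero_smul, add_zero, smul_eq_mul]
  rw [add_sub_cancel_left, norm_smul, Real.norm_of_nonneg hs0'.le] at hs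
  rw [inv_mul_eq_div, le_div_iff₀ hs0']
  linarith

/-- Perturbed minimization of the distance of `h` to `D` near a point that is almost feasible: if
there is no feasible point nearby, there is a nearby point whose residual is a proximal normal
which is almost annihilated by the adjoint of the derivative. -/
lemma exists_almost_stationary [ProperSpace E] [ProperSpace F] {D : Set F} (hD : IsClosed D)
    (hDne : D.Nonempty) {h : E → F} {h' : E → E →L[ℝ] F} {x₀ : E} {ρ ε : ℝ} (hε : 0 < ε)
    (hh : ∀ x ∈ closedBall x₀ ρ, HasFDerivAt h (h' x) x)
    (hsmall : infDist (h x₀) D < ε * ρ) (hno : ∀ x ∈ ball x₀ ρ, h x ∉ D) :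
    ∃ x ∈ ball x₀ ρ, ∃ v : F, ∃ r : ℝ, ‖v‖ = 1 ∧ 0 < r ∧ r ≤ infDist (h x₀) D ∧
      v ∈ rnc1 D (h x - r • v) ∧ ∀ w, |⟪v, h' x w⟫| ≤ ε * ‖w‖ := by
  have hρ : 0 < ρ := pos_of_mul_pos_right (infDist_nonneg.trans_lt hsmall) hε.le
  have hcont : ContinuousOn (fun x => infDist (h x) D + ε * ‖x - x₀‖) (closedBall x₀ ρ) := by
    have h1 : ContinuousOn h (closedBall x₀ ρ) := fun x hx =>
      (hh x hx).continuousAt.continuousWithinAt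
    have h2 : ContinuousOn (fun x => infDist (h x) D) (closedBall x₀ ρ) :=
      (continuous_infDist_pt D).comp_continuousOn h1
    fun_prop
  obtain ⟨x, hx, hxmin⟩ := (isCompact_closedBall x₀ ρ).exists_isMinOn
    ⟨x₀, mem_closedBall_self hρ.le⟩ hcont
  have hx0 : infDist (h x) D + ε * ‖x - x₀‖ ≤ infDist (h x₀) D := by
    simpa using hxmin (mem_closedBall_self hρ.le)
  have hxball : x ∈ ball x₀ ρ := by
    rw [mem_ball, dist_eq_norm]
    have := infDist_nonneg (x := h x) (s := D)
    exact lt_of_mul_lt_mul_left (by linarith) hε.le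
  obtain ⟨y, hyD, hy⟩ := hD.exists_infDist_eq_dist hDne (h x)
  have hxy : h x ≠ y := fun he => hno x hxball (he ▸ hyD)
  have hr : 0 < ‖h x - y‖ := norm_pos_iff.2 (sub_ne_zero.2 hxy)
  have hmin : ∀ᶠ z in 𝓝 x, ‖h x - y‖ ≤ ‖h z - y‖ + ε * ‖z - x‖ := by
    filter_upwards [isOpen_ball.mem_nhds hxball] with z hz
    have h1 : infDist (h x) D + ε * ‖x - x₀‖ ≤ infDist (h z) D + ε * ‖z - x₀‖ :=
      hxmin (ball_subset_closedBall hz)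
    have h2 := infDist_le_dist_of_mem (x := h z) hyD
    rw [dist_eq_norm] at h2 hy
    have h3 : ‖z - x₀‖ ≤ ‖z - x‖ + ‖x - x₀‖ := norm_sub_le_norm_sub_add_norm_sub z x x₀
    have h4 := mul_le_mul_of_nonneg_left h3 hε.le
    linarith
  have hstat := inner_fderiv_ge_of_eventually (hh x hx) hxy hmin
  refine ⟨x, hxball, ‖h x - y‖⁻¹ • (h x - y), ‖h x - y‖, ?_, hr, ?_, ?_, fun w => ?_⟩
  · rw [norm_smul, norm_inv, norm_norm, inv_mul_cancel₀ hr.ne']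
  · rw [← dist_eq_norm, ← hy]
    have := mul_nonneg hε.le (norm_nonneg (x - x₀))
    linarith
  · rw [smul_inv_smul₀ hr.ne', sub_sub_cancel]
    exact smul_sub_mem_rnc1_of_infDist_eq hyD hy (inv_nonneg.2 hr.le)
  · have h1 := hstat w
    have h2 := hstat (-w)
    rw [map_neg, inner_neg_right, norm_neg] at h2
    exact abs_le.2 ⟨h1, by linarith⟩

end Variational

section SecondOrder

variable {E F : Type*} [NormedAddCommGroup E] [InnerProductSpace ℝ E]
  [NormedAddCommGroup F] [InnerProductSpace ℝ F]

/-- Second-order Taylor expansion with Peano remainder. -/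
lemma isLittleO_second_order_taylor {g : E → F} {g' : E → E →L[ℝ] F} {B : E →L[ℝ] E →L[ℝ] F}
    {xb : E} (hg : ∀ᶠ x in 𝓝 xb, HasFDerivAt g (g' x) x) (hB : HasFDerivAt g' B xb) :
    (fun x => g x - g xb - g' xb (x - xb) - (1 / 2 : ℝ) • B (x - xb) (x - xb))
      =o[𝓝 xb] fun x => ‖x - xb‖ ^ 2 := by
  refine Asymptotics.isLittleO_iff.2 fun c hc => ?_
  obtain ⟨δ, hδ, hball⟩ := Metric.eventually_nhds_iff_ball.1
    (hg.and (Asymptotics.isLittleO_iff.1 hB.isLittleO hc))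
  filter_upwards [ball_mem_nhds xb hδ] with x hx
  set d := x - xb with hd
  have hnd : ‖d‖ < δ := by simpa [dist_eq_norm] using hx
  have hseg : ∀ s ∈ Icc (0 : ℝ) 1, xb + s • d ∈ ball xb δ := fun s hs => by
    rw [mem_ball, dist_eq_norm, add_sub_cancel_left, norm_smul, Real.norm_of_nonneg hs.1]
    exact (mul_le_of_le_one_left (norm_nonneg d) hs.2).trans_lt hnd
  have hderiv : ∀ s ∈ Icc (0 : ℝ) 1, HasDerivWithinAt
      (fun s : ℝ => g (xb + s • d) - s • g' xb d - (s ^ 2 / 2) • B d d)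
      ((g' (xb + s • d) - g' xb - B (s • d)) d) (Icc 0 1) s := fun s hs => by
    have hline : HasDerivAt (fun s : ℝ => xb + s • d) d s := by
      simpa using ((hasDerivAt_id s).smul_const d).const_add xb
    have h1 := (hball _ (hseg s hs)).1.comp_hasDerivAt s hline
    have h2 : HasDerivAt (fun s : ℝ => s • g' xb d) (g' xb d) s := by
      simpa using (hasDerivAt_id s).smul_const (g' xb d)
    have h3 : HasDerivAt (fun s : ℝ => (s ^ 2 / 2) • B d d) (s • B d d) s := by
      have : HasDerivAt (fun s : ℝ => s ^ 2 / 2) s s := by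
        simpa using (hasDerivAt_pow 2 s).div_const 2
      exact this.smul_const _
    convert ((h1.sub h2).sub h3).hasDerivWithinAt using 1
    · rfl
    · simp
  have hbound : ∀ s ∈ Ico (0 : ℝ) 1,
      ‖(g' (xb + s • d) - g' xb - B (s • d)) d‖ ≤ c * ‖d‖ ^ 2 := fun s hs => by
    have h1 := (hball _ (hseg s (Ico_subset_Icc_self hs))).2
    rw [add_sub_cancel_left] at h1
    have h2 : ‖s • d‖ ≤ ‖d‖ := by
      rw [norm_smul, Real.norm_of_nonneg hs.1]
      exact mul_le_of_le_one_left (norm_nonneg d) hs.2.le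
    calc _ ≤ ‖g' (xb + s • d) - g' xb - B (s • d)‖ * ‖d‖ := ContinuousLinearMap.le_opNorm _ _
      _ ≤ c * ‖d‖ * ‖d‖ := by
        gcongr
        exact h1.trans (by gcongr)
      _ = c * ‖d‖ ^ 2 := by ring
  have key := norm_image_sub_le_of_norm_deriv_le_segment_01' hderiv hbound
  rw [Real.norm_of_nonneg (sq_nonneg ‖d‖)]
  convert key using 2
  simp only [one_smul, zero_smul, hd, add_sub_cancel, add_zero]
  norm_num
  abel

/-- A sequence of almost stationary points whose residual is a normal to the union of polyhedra
produces a nonzero direction and multiplier satisfying the second-order condition. -/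
lemma exists_direction_multiplier_of_almost_stationary [ProperSpace E] [ProperSpace F]
    {N : ℕ} {C : Fin N → Set F} (hC : ∀ j, IsPolyhedron (C j))
    {g : E → F} {g' : E → E →L[ℝ] F} {B : E →L[ℝ] E →L[ℝ] F} {xb : E}
    (hg : ∀ᶠ x in 𝓝 xb, HasFDerivAt g (g' x) x) (hB : HasFDerivAt g' B xb)
    {ε : ℕ → ℝ} (hε : Tendsto ε atTop (𝓝 0))
    {x : ℕ → E} (hx : Tendsto x atTop (𝓝 xb)) (hxb : ∀ k, x k ≠ xb)
    {v e : ℕ → F} {r : ℕ → ℝ} {T : ℕ → E →L[ℝ] F}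
    (hv : ∀ k, ‖v k‖ = 1) (hr : ∀ k, 0 < r k) (hrε : ∀ k, r k ≤ ε k * ‖x k - xb‖)
    (he : ∀ k, ‖e k‖ ≤ ε k * ‖x k - xb‖ ^ 2)
    (hnormal : ∀ k, v k ∈ rnc1 (⋃ j, C j) (g (x k) + e k - r k • v k))
    (hT : Tendsto T atTop (𝓝 (g' xb))) (hTv : ∀ k w, |⟪v k, T k w⟫| ≤ ε k * ‖w‖) :
    ∃ (u : E) (vs : F), u ≠ 0 ∧ vs ≠ 0 ∧ g' xb u ∈ tcone (⋃ j, C j) (g xb) ∧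
      (∀ w, ⟪vs, g' xb w⟫ = 0) ∧ vs ∈ dnc1 (⋃ j, C j) (g xb) (g' xb u) ∧ 0 ≤ ⟪vs, B u u⟫ := by
  have hτ : ∀ k, 0 < ‖x k - xb‖ := fun k => norm_pos_iff.2 (sub_ne_zero.2 (hxb k))
  obtain ⟨⟨u, vs⟩, ⟨hu, hvs⟩, φ, hφ, hlim⟩ :=
    ((isCompact_sphere (0 : E) 1).prod (isCompact_sphere (0 : F) 1)).tendsto_subseq
      (x := fun k => (‖x k - xb‖⁻¹ • (x k - xb), v k)) fun k => by
        refine ⟨?_, ?_⟩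
        · simp [norm_smul, (hτ k).ne']
        · simp [hv k]
  have hφt := hφ.tendsto_atTop
  have hul : Tendsto (fun k => ‖x (φ k) - xb‖⁻¹ • (x (φ k) - xb)) atTop (𝓝 u) :=
    (continuous_fst.tendsto _).comp hlim
  have hvl : Tendsto (fun k => v (φ k)) atTop (𝓝 vs) := (continuous_snd.tendsto _).comp hlim
  replace hε := hε.comp hφt
  replace hx := hx.comp hφt
  replace hT := hT.comp hφt
  simp only [mem_sphere_iff_norm, sub_zero] at hu hvs
  have hvsv : ∀ᶠ k in atTop, 0 < ⟪vs, v (φ k)⟫ := by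
    refine (tendsto_const_nhds.inner hvl).eventually_const_lt ?_
    rw [real_inner_self_eq_norm_sq, hvs]
    norm_num
  have hkernel : ∀ w, ⟪vs, g' xb w⟫ = 0 := fun w => by
    have h1 : Tendsto (fun k => ⟪v (φ k), T (φ k) w⟫) atTop (𝓝 ⟪vs, g' xb w⟫) :=
      hvl.inner (((ContinuousLinearMap.apply ℝ F w).continuous.tendsto _).comp hT)
    have h2 : Tendsto (fun k => ε (φ k) * ‖w‖) atTop (𝓝 0) := by
      simpa using hε.mul_const ‖w‖
    exact tendsto_nhds_unique h1 (squeeze_zero_norm (fun k => hTv (φ k) w) h2)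
  have hτl : Tendsto (fun k => ‖x (φ k) - xb‖) atTop (𝓝 0) := by
    simpa using (hx.sub_const xb).norm
  -- the projections onto the union of polyhedra and their rescaled displacements
  set y : ℕ → F := fun k => g (x (φ k)) + e (φ k) - r (φ k) • v (φ k) with hy
  have hyw : ∀ k, g xb + ‖x (φ k) - xb‖ • (‖x (φ k) - xb‖⁻¹ • (y k - g xb)) = y k := fun k => by
    rw [smul_inv_smul₀ (hτ _).ne', add_sub_cancel]
  have hw : Tendsto (fun k => ‖x (φ k) - xb‖⁻¹ • (y k - g xb)) atTop (𝓝 (g' xb u)) := by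
    have h1 : Tendsto (fun k => ‖x (φ k) - xb‖⁻¹ •
        (g (x (φ k)) - g xb - g' xb (x (φ k) - xb))) atTop (𝓝 0) := by
      have := (hg.self_of_nhds.isLittleO.comp_tendsto hx).norm_right
      exact this.tendsto_inv_smul_nhds_zero
    have h2 : Tendsto (fun k => ‖x (φ k) - xb‖⁻¹ • e (φ k)) atTop (𝓝 0) := by
      refine squeeze_zero_norm (a := fun k => ε (φ k) * ‖x (φ k) - xb‖) (fun k => ?_)
        (by simpa using hε.mul hτl)
      have := hτ (φ k)
      rw [norm_smul, norm_inv, norm_norm, inv_mul_le_iff₀ this]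
      linarith [he (φ k)]
    have h3 : Tendsto (fun k => ‖x (φ k) - xb‖⁻¹ • (r (φ k) • v (φ k))) atTop (𝓝 0) := by
      refine squeeze_zero_norm (fun k => ?_) hε
      have := hτ (φ k)
      rw [norm_smul, norm_smul, hv, mul_one, norm_inv, norm_norm, inv_mul_le_iff₀ this,
        Real.norm_of_nonneg (hr _).le]
      have := hrε (φ k)
      simp only [Function.comp]
      linarith
    have h4 := ((h1.add h2).sub h3).add (((g' xb).continuous.tendsto u).comp hul)
    simp only [add_zero, sub_zero, zero_add] at h4
    refine h4.congr fun k => ?_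
    simp only [Function.comp, map_smul, hy, ← smul_add, ← smul_sub]
    congr 1
    abel
  have hyl : Tendsto y atTop (𝓝 (g xb)) := by
    have := tendsto_const_nhds (x := g xb).add (hτl.smul hw)
    simp only [hyw] at this
    simpa using this
  refine ⟨u, vs, ?_, ?_, ?_, hkernel, ?_, ?_⟩
  · rintro rfl
    simp at hu
  · rintro rfl
    simp at hvs
  · exact ⟨_, _, fun k => hτ (φ k), hτl, hw, fun k => by rw [hyw]; exact (hnormal (φ k)).1⟩
  · exact ⟨_, _, _, fun k => hτ (φ k), hτl, hw, hvl, fun k => by rw [hyw]; exact hnormal (φ k)⟩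
  have hquad : Tendsto (fun k => ⟪vs, (‖x (φ k) - xb‖ ^ 2)⁻¹ •
      (g (x (φ k)) - g xb - g' xb (x (φ k) - xb))⟫ + ε (φ k)) atTop
      (𝓝 (⟪vs, (1 / 2 : ℝ) • B u u⟫ + 0)) := by
    refine (tendsto_const_nhds.inner ?_).add hε
    have h1 : Tendsto (fun k => (‖x (φ k) - xb‖ ^ 2)⁻¹ • (g (x (φ k)) - g xb -
        g' xb (x (φ k) - xb) - (1 / 2 : ℝ) • B (x (φ k) - xb) (x (φ k) - xb))) atTop (𝓝 0) := by
      have := (isLittleO_second_order_taylor hg hB).comp_tendsto hx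
      exact this.tendsto_inv_smul_nhds_zero
    have h2 : Tendsto (fun k => (1 / 2 : ℝ) • B (‖x (φ k) - xb‖⁻¹ • (x (φ k) - xb))
        (‖x (φ k) - xb‖⁻¹ • (x (φ k) - xb))) atTop (𝓝 ((1 / 2 : ℝ) • B u u)) :=
      ((isBoundedBilinearMap_apply.continuous.tendsto (B u, u)).comp
        (((B.continuous.tendsto u).comp hul).prodMk_nhds hul)).const_smul _
    have h3 := h1.add h2
    rw [zero_add] at h3
    refine h3.congr fun k => ?_
    rw [smul_sub _ _ ((1 / 2 : ℝ) • B _ _)]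
    simp only [map_smul, smul_apply, smul_smul]
    rw [sub_add_eq_add_sub, sub_eq_iff_eq_add]
    congr 2
    ring
  have hnonneg : 0 ≤ ⟪vs, (1 / 2 : ℝ) • B u u⟫ + 0 := by
    refine ge_of_tendsto_of_frequently hquad
      (((frequently_inner_sub_eq_zero hC (fun k => hnormal (φ k)) hyl hvl).and_eventually
        hvsv).mono fun k ⟨hk0, hkv⟩ => ?_)
    have hτk := hτ (φ k)
    rw [real_inner_smul_right, inner_sub_right, hkernel, sub_zero, inner_sub_right]
    have hek : -(ε (φ k) * ‖x (φ k) - xb‖ ^ 2) ≤ -⟪vs, e (φ k)⟫ := by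
      have := (real_inner_le_norm vs (e (φ k))).trans_eq (by rw [hvs, one_mul])
      linarith [he (φ k)]
    rw [inner_sub_right, inner_sub_right, inner_add_right, real_inner_smul_right] at hk0
    have hrk := mul_pos (hr (φ k)) hkv
    rw [inv_mul_eq_div, ← neg_le_iff_add_nonneg, le_div_iff₀ (pow_pos hτk 2)]
    linarith
  rw [add_zero, real_inner_smul_right] at hnonneg
  linarith

end SecondOrder

section Stability

variable {E F : Type*} [NormedAddCommGroup E] [InnerProductSpace ℝ E]
  [NormedAddCommGroup F] [InnerProductSpace ℝ F]

lemma tendsto_div_natCast_add_two (c : ℝ) :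
    Tendsto (fun k : ℕ => c / ((k : ℝ) + 2)) atTop (𝓝 0) :=
  tendsto_const_nhds.div_atTop (tendsto_atTop_add_const_right _ _ tendsto_natCast_atTop_atTop)

lemma tendsto_of_norm_sub_le_div {X : Type*} [SeminormedAddCommGroup X] {x : ℕ → X}
    {xb : X} {c : ℝ}
    (h : ∀ k, ‖x k - xb‖ ≤ c / ((k : ℝ) + 2)) : Tendsto x atTop (𝓝 xb) :=
  tendsto_iff_norm_sub_tendsto_zero.2
    (squeeze_zero (fun _ => norm_nonneg _) h (tendsto_div_natCast_add_two c))

/-- The second-order condition implies metric subregularity of `g - D`. -/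
lemma exists_infDist_preimage_le [ProperSpace E] [ProperSpace F]
    {N : ℕ} {C : Fin N → Set F} (hC : ∀ j, IsPolyhedron (C j))
    {g : E → F} {g' : E → E →L[ℝ] F} {B : E →L[ℝ] E →L[ℝ] F} {xb : E}
    (hbar : g xb ∈ ⋃ j, C j)
    (hg : ∀ᶠ x in 𝓝 xb, HasFDerivAt g (g' x) x) (hB : HasFDerivAt g' B xb)
    (hcond : ¬ ∃ (u : E) (vs : F), u ≠ 0 ∧ vs ≠ 0 ∧ g' xb u ∈ tcone (⋃ j, C j) (g xb) ∧
      (∀ w, ⟪vs, g' xb w⟫ = 0) ∧ vs ∈ dnc1 (⋃ j, C j) (g xb) (g' xb u) ∧ 0 ≤ ⟪vs, B u u⟫) :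
    ∃ κ : ℝ, 0 ≤ κ ∧ ∀ᶠ x in 𝓝 xb,
      infDist x {x | g x ∈ ⋃ j, C j} ≤ κ * infDist (g x) (⋃ j, C j) := by
  by_contra hcon
  push Not at hcon
  have hclosed : IsClosed (⋃ j, C j) := isClosed_iUnion_of_finite fun j => (hC j).isClosed
  obtain ⟨η, hη, hball⟩ := Metric.eventually_nhds_iff_ball.1 hg
  have hseq : ∀ k : ℕ, ∃ x : E, ∃ v : F, ∃ r : ℝ, x ≠ xb ∧ ‖x - xb‖ ≤ 2 / ((k : ℝ) + 2) ∧
      ‖v‖ = 1 ∧ 0 < r ∧ r ≤ 1 / ((k : ℝ) + 2) * ‖x - xb‖ ∧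
      v ∈ rnc1 (⋃ j, C j) (g x - r • v) ∧
      (∀ w, |⟪v, g' x w⟫| ≤ 1 / ((k : ℝ) + 2) * ‖w‖) := fun k => by
    set a : ℝ := (k : ℝ) + 2 with ha
    have ha2 : 2 ≤ a := by simp [ha]
    have ha0 : 0 < a := by linarith
    obtain ⟨x₀, hx₀, hx₀η, hx₀a⟩ := ((hcon (a ^ 2) (sq_nonneg a)).and_eventually
      ((eventually_mem_set.2 (ball_mem_nhds xb (half_pos hη))).and (ball_mem_nhds xb (inv_pos.2 ha0)))).exists
    replace hx₀η : dist x₀ xb < η / 2 := hx₀η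
    set S : Set E := {x | g x ∈ ⋃ j, C j} with hS
    set f : ℝ := infDist (g x₀) (⋃ j, C j) with hf
    have hδd : infDist x₀ S ≤ dist x₀ xb := infDist_le_dist_of_mem hbar
    set δ : ℝ := infDist x₀ S with hδ
    have hf0 : 0 ≤ f := infDist_nonneg
    have hδ0 : 0 < δ := lt_of_le_of_lt (by positivity) hx₀
    have hρδ : δ / a ≤ δ / 2 := by gcongr
    have hfδ : f < 1 / a * (δ / a) := by
      rw [div_mul_div_comm, one_mul, lt_div_iff₀ (by positivity)]
      linarith
    obtain ⟨x, hx, v, r, hv, hr, hrf, hnormal, hstat⟩ :=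
      exists_almost_stationary hclosed ⟨_, hbar⟩ (h := g) (h' := g') (x₀ := x₀) (ρ := δ / a)
        (ε := 1 / a) (by positivity)
        (fun x hx => by
          refine hball x ?_
          rw [mem_closedBall] at hx
          rw [mem_ball]
          linarith [dist_triangle x x₀ xb])
        hfδ
        (fun x hx hxD => by
          have h1 : δ ≤ dist x₀ x := infDist_le_dist_of_mem (s := S) hxD
          rw [mem_ball, dist_comm] at hx
          linarith)
    rw [mem_ball, dist_comm] at hx
    have hlow : dist x₀ xb / 2 ≤ ‖x - xb‖ := by
      rw [← dist_eq_norm]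
      linarith [dist_triangle x₀ x xb]
    have hup : ‖x - xb‖ ≤ 2 * dist x₀ xb := by
      rw [← dist_eq_norm]
      linarith [dist_triangle x x₀ xb, dist_comm x x₀]
    refine ⟨x, v, r, ?_, ?_, hv, hr, ?_, hnormal, hstat⟩
    · rintro rfl
      simp only [sub_self, norm_zero] at hlow
      linarith
    · rw [div_eq_mul_inv]
      linarith
    · have h1 : δ / a ≤ ‖x - xb‖ := by linarith
      exact (hrf.trans hfδ.le).trans (by gcongr)
  choose x v r hxb hxl hv hr hrx hnormal hstat using hseq
  have hx := tendsto_of_norm_sub_le_div hxl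
  exact hcond (exists_direction_multiplier_of_almost_stationary hC hg hB
    (tendsto_div_natCast_add_two 1) hx hxb hv hr hrx (e := fun _ => 0)
    (fun k => by rw [norm_zero]; positivity)
    (fun k => by rw [add_zero]; exact hnormal k)
    (hB.continuousAt.tendsto.comp hx) hstat)

/-- Under metric subregularity, a linearized tangent direction is followed by feasible points. -/
lemma eventually_exists_feasible_of_tangent
    {N : ℕ} {C : Fin N → Set F} (hC : ∀ j, IsPolyhedron (C j))
    {g : E → F} {A : E →L[ℝ] F} {xb : E} (hbar : g xb ∈ ⋃ j, C j) (hg : HasFDerivAt g A xb)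
    {κ : ℝ} (hκ : 0 ≤ κ) (hsub : ∀ᶠ x in 𝓝 xb,
      infDist x {x | g x ∈ ⋃ j, C j} ≤ κ * infDist (g x) (⋃ j, C j))
    {u : E} (hu : u ≠ 0) (huT : A u ∈ tcone (⋃ j, C j) (g xb)) :
    ∀ᶠ t : ℝ in 𝓝[>] 0, ∃ x, g x ∈ ⋃ j, C j ∧ t ≤ ‖x - xb‖ ∧ ‖x - xb‖ ≤ 3 * t := by
  have hu0 : 0 < ‖u‖ := norm_pos_iff.2 hu
  have hscale : Tendsto (fun t : ℝ => t * (2 / ‖u‖)) (𝓝[>] 0) (𝓝[>] 0) := by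
    refine tendsto_nhdsWithin_iff.2 ⟨?_, ?_⟩
    · have : Tendsto (fun t : ℝ => t * (2 / ‖u‖)) (𝓝 0) (𝓝 (0 * (2 / ‖u‖))) :=
        tendsto_id.mul_const _
      rw [zero_mul] at this
      exact this.mono_left nhdsWithin_le_nhds
    · filter_upwards [self_mem_nhdsWithin] with t ht
      exact mul_pos (mem_Ioi.1 ht) (by positivity)
  have hline : Tendsto (fun t : ℝ => xb + (t * (2 / ‖u‖)) • u) (𝓝[>] 0) (𝓝 xb) := by
    have := tendsto_const_nhds (x := xb).add
      ((tendsto_nhds_of_tendsto_nhdsWithin hscale).smul_const u)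
    simpa using this
  have hc : 0 < 1 / (4 * (κ + 1)) := by positivity
  filter_upwards [hscale.eventually (eventually_add_smul_mem_of_mem_tcone hC huT),
    hline.eventually hsub, hline.eventually (Asymptotics.isLittleO_iff.1 hg.isLittleO hc),
    self_mem_nhdsWithin] with t htD hts hto ht0
  have ht : 0 < t := ht0
  set x₀ := xb + (t * (2 / ‖u‖)) • u with hx₀
  have hx₀n : ‖x₀ - xb‖ = 2 * t := by
    rw [hx₀, add_sub_cancel_left, norm_smul, Real.norm_of_nonneg (by positivity)]
    field_simp
  have h1 : infDist (g x₀) (⋃ j, C j) ≤ 1 / (4 * (κ + 1)) * (2 * t) := by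
    refine (infDist_le_dist_of_mem htD).trans ?_
    rw [dist_eq_norm, ← hx₀n]
    refine le_trans (le_of_eq ?_) hto
    rw [sub_sub, hx₀, add_sub_cancel_left, map_smul]
  have h2 : infDist x₀ {x | g x ∈ ⋃ j, C j} < t := by
    refine hts.trans_lt ((mul_le_mul_of_nonneg_left h1 hκ).trans_lt ?_)
    rw [show κ * (1 / (4 * (κ + 1)) * (2 * t)) = (κ * t) / (2 * (κ + 1)) by field_simp; ring,
      div_lt_iff₀ (by positivity)]
    nlinarith
  obtain ⟨x, hxD, hx⟩ := (infDist_lt_iff ⟨xb, hbar⟩).1 h2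
  rw [dist_eq_norm] at hx
  refine ⟨x, hxD, ?_, ?_⟩
  · linarith [norm_sub_le_norm_sub_add_norm_sub x₀ x xb]
  · linarith [norm_sub_le_norm_sub_add_norm_sub x x₀ xb, norm_sub_rev x x₀]

/-- If the perturbed system has no solutions near `xb` at the rate `√‖p - pb‖`, then there are
almost stationary points at which the perturbation is of higher than second order. -/
lemma exists_almost_stationary_of_frequently_no_solution [ProperSpace E] [ProperSpace F]
    {P : Type*} [NormedAddCommGroup P] {D : Set F} (hD : IsClosed D)
    {h : P → E → F} {h' : P → E → E →L[ℝ] F} {pb : P} {xb : E} (hbar : h pb xb ∈ D)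
    (hh : ∀ᶠ z : P × E in 𝓝 (pb, xb), HasFDerivAt (h z.1) (h' z.1 z.2) z.2)
    {L : ℝ} (hL : 0 ≤ L)
    (hLip : ∀ᶠ z : P × E in 𝓝 (pb, xb), ‖h z.1 z.2 - h pb z.2‖ ≤ L * ‖z.1 - pb‖)
    (hfeas : ∀ᶠ t : ℝ in 𝓝[>] 0, ∃ x, h pb x ∈ D ∧ t ≤ ‖x - xb‖ ∧ ‖x - xb‖ ≤ 3 * t)
    (hcon : ∀ M : ℝ, 0 ≤ M → ∃ᶠ p in 𝓝 pb, ∀ x, h p x ∈ D → M * √‖p - pb‖ < ‖x - xb‖)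
    {a : ℝ} (ha2 : 2 ≤ a) :
    ∃ p : P, ∃ x : E, ∃ v : F, ∃ r : ℝ, x ≠ xb ∧ ‖p - pb‖ ≤ 1 / a ∧ ‖x - xb‖ ≤ 4 / a ∧
      ‖v‖ = 1 ∧ 0 < r ∧ r ≤ (4 * L + 1) / a * ‖x - xb‖ ∧
      ‖h p x - h pb x‖ ≤ (4 * L + 1) / a * ‖x - xb‖ ^ 2 ∧
      v ∈ rnc1 D (h p x - r • v) ∧ (∀ w, |⟪v, h' p x w⟫| ≤ (4 * L + 1) / a * ‖w‖) := by
  obtain ⟨η₁, hη₁, hfeas⟩ := mem_nhdsGT_iff_exists_Ioo_subset.1 hfeas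
  replace hη₁ : 0 < η₁ := hη₁
  obtain ⟨η, hη, hprod⟩ := Metric.eventually_nhds_iff.1 (hh.and hLip)
  have hsqrt : Tendsto (fun p : P => √‖p - pb‖) (𝓝 pb) (𝓝 0) := by
    have hcont : Continuous fun p : P => √‖p - pb‖ := by fun_prop
    simpa using hcont.tendsto pb
  have ha0 : 0 < a := by linarith
  obtain ⟨p, hno, hpη, hq1, hq2, hq3, hq4⟩ :=
    ((hcon (4 * a) (by positivity)).and_eventually ((eventually_mem_set.2 (ball_mem_nhds pb hη)).and
      ((hsqrt.eventually_lt_const (div_pos hη₁ ha0)).and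
      ((hsqrt.eventually_lt_const (show 0 < 1 / (a * a) by positivity)).and
      ((hsqrt.eventually_lt_const (show 0 < 1 / (2 * (L + 1)) by positivity)).and
      (hsqrt.eventually_lt_const (show 0 < η / (4 * a) by positivity))))))).exists
  have hq0 : 0 ≤ √‖p - pb‖ := Real.sqrt_nonneg _
  have hqsq : √‖p - pb‖ ^ 2 = ‖p - pb‖ := Real.sq_sqrt (norm_nonneg _)
  set q : ℝ := √‖p - pb‖ with hq
  have hqpos : 0 < q := by
    refine hq0.lt_of_ne fun hq0' => ?_
    have hp : p = pb := by
      rw [← sub_eq_zero, ← norm_eq_zero, ← hqsq, ← hq0']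
      norm_num
    have := hno xb (by rw [hp]; exact hbar)
    rw [← hq0', mul_zero, sub_self, norm_zero] at this
    exact lt_irrefl _ this
  rw [lt_div_iff₀ (by positivity)] at hq1 hq2 hq3 hq4
  set t : ℝ := a * q with ht
  have ht0 : 0 < t := mul_pos ha0 hqpos
  have hta : a * t < 1 := by rw [ht]; linarith
  have ht1 : t < 1 := by nlinarith
  obtain ⟨x₀, hx₀D, hx₀l, hx₀u⟩ := hfeas (show t ∈ Ioo 0 η₁ from ⟨ht0, by rw [ht]; linarith⟩)
  have h4t : 4 * t < η := by rw [ht]; linarith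
  have hgood : ∀ x : E, ‖x - xb‖ < η →
      HasFDerivAt (h p) (h' p x) x ∧ ‖h p x - h pb x‖ ≤ L * q ^ 2 := fun x hx => by
    rw [hqsq]
    refine hprod (y := (p, x)) ?_
    rw [Prod.dist_eq]
    exact max_lt hpη (by rwa [dist_eq_norm])
  have hρt : (L + 1) * a * q ^ 2 ≤ t / 2 := by
    rw [ht, show (L + 1) * a * q ^ 2 = (a * q) * ((L + 1) * q) by ring]
    nlinarith
  have hsmall : infDist (h p x₀) D ≤ L * q ^ 2 := by
    refine (infDist_le_dist_of_mem hx₀D).trans ?_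
    rw [dist_eq_norm]
    exact (hgood x₀ (by linarith)).2
  have hclose : ∀ x, dist x x₀ ≤ (L + 1) * a * q ^ 2 →
      t / 2 ≤ ‖x - xb‖ ∧ ‖x - xb‖ < 4 * t := fun x hx => by
    rw [dist_eq_norm] at hx
    constructor
    · linarith [norm_sub_le_norm_sub_add_norm_sub x₀ x xb, norm_sub_rev x x₀]
    · linarith [norm_sub_le_norm_sub_add_norm_sub x x₀ xb]
  obtain ⟨x, hx, v, r, hv, hr, hrf, hnormal, hstat⟩ :=
    exists_almost_stationary hD ⟨_, hbar⟩ (h := h p) (h' := h' p) (x₀ := x₀)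
      (ρ := (L + 1) * a * q ^ 2) (ε := 1 / a) (by positivity)
      (fun x hx => (hgood x ((hclose x hx).2.trans h4t)).1)
      (hsmall.trans_lt (by field_simp; linarith))
      (fun x hx hxD => by
        have h1 := hno x hxD
        have h2 := (hclose x (mem_ball.1 hx).le).2
        rw [ht] at h2
        linarith)
  obtain ⟨hxl, hxu⟩ := hclose x (mem_ball.1 hx).le
  have haq : a * q ^ 2 ≤ t ^ 2 := by
    rw [ht, mul_pow]
    nlinarith [sq_nonneg q, mul_nonneg ha0.le (sq_nonneg q)]
  have hxt : t ^ 2 ≤ 4 * ‖x - xb‖ ^ 2 := by nlinarith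
  have hLq : L * q ^ 2 ≤ (4 * L + 1) / a * ‖x - xb‖ ^ 2 := by
    rw [div_mul_eq_mul_div, le_div_iff₀ ha0]
    linarith [mul_le_mul_of_nonneg_left (haq.trans hxt) hL, sq_nonneg ‖x - xb‖]
  have htt : t ^ 2 ≤ t := by nlinarith
  refine ⟨p, x, v, r, ?_, ?_, ?_, hv, hr, ?_, ?_, hnormal, fun w => ?_⟩
  · rintro rfl
    rw [sub_self, norm_zero] at hxl
    linarith
  · rw [← hqsq, le_div_iff₀ ha0]
    linarith
  · rw [le_div_iff₀ ha0]
    linarith [mul_le_mul_of_nonneg_left hxu.le ha0.le]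
  · refine (hrf.trans hsmall).trans ?_
    have haq' : a * q ^ 2 ≤ 4 * ‖x - xb‖ := by linarith
    rw [div_mul_eq_mul_div, le_div_iff₀ ha0]
    linarith [mul_le_mul_of_nonneg_left haq' hL, norm_nonneg (x - xb)]
  · exact (hgood x (hxu.trans h4t)).2.trans hLq
  · refine (hstat w).trans ?_
    gcongr
    linarith

/-- Local solvability of the perturbed system with a Hölder estimate of order `1 / 2`. -/
lemma eventually_exists_solution_near [ProperSpace E] [ProperSpace F]
    {P : Type*} [NormedAddCommGroup P]
    {N : ℕ} {C : Fin N → Set F} (hC : ∀ j, IsPolyhedron (C j))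
    {h : P → E → F} {h' : P → E → E →L[ℝ] F} {pb : P} {xb : E}
    {g' : E → E →L[ℝ] F} {B : E →L[ℝ] E →L[ℝ] F} (hbar : h pb xb ∈ ⋃ j, C j)
    (hg : ∀ᶠ x in 𝓝 xb, HasFDerivAt (h pb) (g' x) x) (hB : HasFDerivAt g' B xb)
    (hh : ∀ᶠ z : P × E in 𝓝 (pb, xb), HasFDerivAt (h z.1) (h' z.1 z.2) z.2)
    (hh' : Tendsto (fun z : P × E => h' z.1 z.2) (𝓝 (pb, xb)) (𝓝 (g' xb)))
    {L : ℝ} (hL : 0 ≤ L)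
    (hLip : ∀ᶠ z : P × E in 𝓝 (pb, xb), ‖h z.1 z.2 - h pb z.2‖ ≤ L * ‖z.1 - pb‖)
    (hcond : ¬ ∃ (u : E) (vs : F), u ≠ 0 ∧ vs ≠ 0 ∧ g' xb u ∈ tcone (⋃ j, C j) (h pb xb) ∧
      (∀ w, ⟪vs, g' xb w⟫ = 0) ∧ vs ∈ dnc1 (⋃ j, C j) (h pb xb) (g' xb u) ∧ 0 ≤ ⟪vs, B u u⟫)
    {u : E} (hu : u ≠ 0) (huT : g' xb u ∈ tcone (⋃ j, C j) (h pb xb)) :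
    ∃ M : ℝ, 0 ≤ M ∧ ∀ᶠ p in 𝓝 pb,
      ∃ x, h p x ∈ ⋃ j, C j ∧ ‖x - xb‖ ≤ M * √‖p - pb‖ := by
  by_contra hcon
  push Not at hcon
  have hclosed : IsClosed (⋃ j, C j) := isClosed_iUnion_of_finite fun j => (hC j).isClosed
  obtain ⟨κ, hκ, hsub⟩ := exists_infDist_preimage_le hC hbar hg hB hcond
  have hfeas := eventually_exists_feasible_of_tangent hC hbar hg.self_of_nhds hκ hsub hu huT
  choose p x v r hxb hpl hxl hv hr hrx he hnormal hstat using fun k : ℕ =>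
    exists_almost_stationary_of_frequently_no_solution hclosed hbar hh hL hLip hfeas hcon
      (a := (k : ℝ) + 2) (by simp)
  have hx := tendsto_of_norm_sub_le_div hxl
  have hp : Tendsto p atTop (𝓝 pb) := tendsto_iff_norm_sub_tendsto_zero.2
    (squeeze_zero (fun _ => norm_nonneg _) hpl (tendsto_div_natCast_add_two 1))
  exact hcond (exists_direction_multiplier_of_almost_stationary hC hg hB
    (tendsto_div_natCast_add_two (4 * L + 1)) hx hxb hv hr hrx
    (e := fun k => h (p k) (x k) - h pb (x k)) he
    (fun k => by rw [add_sub_cancel]; exact hnormal k)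
    (hh'.comp (hp.prodMk_nhds hx)) hstat)

end Stability

/-- Second-order conditions for calmness and local nonemptiness of the solution map of
the parameterized constraint system `0 ∈ G(p,x) - D` with `D` a union of finitely many
convex polyhedra (Theorem `ThClmConstrSystSO`).  Twice Fréchet differentiability of
`G(pb, ·)` at `xb` is expressed by the partial derivative `Gx0` on a neighborhood `V` of
`xb` together with its derivative `B` at `xb`. -/
theorem stmt6 {l n m : ℕ} (G : Es l × Es n → Es m) (D : Set (Es m)) (pb : Es l) (xb : Es n)
    (hD : ∃ (N : ℕ) (C : Fin N → Set (Es m)), (∀ j, IsPolyhedron (C j)) ∧ D = ⋃ j, C j)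
    (hbar : G (pb, xb) ∈ D)
    (V : Set (Es n)) (hV : V ∈ 𝓝 xb)
    (Gx0 : Es n → (Es n →L[ℝ] Es m))
    (hGx0 : ∀ x ∈ V, HasFDerivAt (fun x' => G (pb, x')) (Gx0 x) x)
    (B : Es n →L[ℝ] Es n →L[ℝ] Es m) (hB : HasFDerivAt Gx0 B xb)
    (W : Set (Es l)) (U : Set (Es n)) (hW : W ∈ 𝓝 pb) (hU : U ∈ 𝓝 xb)
    (L' : ℝ) (hL'0 : 0 ≤ L')
    (hLip : ∀ p ∈ W, ∀ x ∈ U, ‖G (p, x) - G (pb, x)‖ ≤ L' * ‖p - pb‖)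
    (hcond : ¬ ∃ (u : Es n) (vs : Es m), u ≠ 0 ∧ vs ≠ 0 ∧
      Gx0 xb u ∈ tcone D (G (pb, xb)) ∧ ContinuousLinearMap.adjoint (Gx0 xb) vs = 0 ∧
      vs ∈ dnc1 D (G (pb, xb)) (Gx0 xb u) ∧ 0 ≤ ⟪vs, B u u⟫) :
    CalmAt (fun p => {x | G (p, x) ∈ D}) pb xb ∧
    (∀ (DG : Es l × Es n → (Es l × Es n →L[ℝ] Es m))
       (Gx : Es l × Es n → (Es n →L[ℝ] Es m))
       (Gxx : Es l × Es n → (Es n →L[ℝ] Es n →L[ℝ] Es m)),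
      (∀ z ∈ W ×ˢ U, HasFDerivAt G (DG z) z) →
      (∀ p ∈ W, ∀ x ∈ U, HasFDerivAt (fun x' => G (p, x')) (Gx (p, x)) x) →
      (∀ p ∈ W, ∀ x ∈ U, HasFDerivAt (fun x' => Gx (p, x')) (Gxx (p, x)) x) →
      ContinuousOn G (W ×ˢ U) → ContinuousOn DG (W ×ˢ U) → ContinuousOn Gxx (W ×ˢ U) →
      (∀ᶠ p in 𝓝 pb, ‖Gx (p, xb) - Gx (pb, xb)‖ ≤ L' * ‖p - pb‖) →
      (∃ ut : Es n, ut ≠ 0 ∧ Gx0 xb ut ∈ tcone D (G (pb, xb))) →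
      ∃ Wt ∈ 𝓝 pb, ∃ Lt : ℝ, 0 ≤ Lt ∧ ∀ p ∈ Wt,
        {x | G (p, x) ∈ D}.Nonempty ∧
        infDist xb {x | G (p, x) ∈ D} ≤ Lt * Real.sqrt ‖p - pb‖) := by
  obtain ⟨N, C, hC, rfl⟩ := hD
  have hg : ∀ᶠ x in 𝓝 xb, HasFDerivAt (fun x' => G (pb, x')) (Gx0 x) x := by
    filter_upwards [hV] with x hx using hGx0 x hx
  have hcond' : ¬ ∃ (u : Es n) (vs : Es m), u ≠ 0 ∧ vs ≠ 0 ∧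
      Gx0 xb u ∈ tcone (⋃ j, C j) (G (pb, xb)) ∧ (∀ w, ⟪vs, Gx0 xb w⟫ = 0) ∧
      vs ∈ dnc1 (⋃ j, C j) (G (pb, xb)) (Gx0 xb u) ∧ 0 ≤ ⟪vs, B u u⟫ := by
    rintro ⟨u, vs, hu, hvs, hT, hker, hN, hnonneg⟩
    refine hcond ⟨u, vs, hu, hvs, hT, ?_, hN, hnonneg⟩
    refine ext_inner_right ℝ fun w => ?_
    rw [ContinuousLinearMap.adjoint_inner_left, hker, inner_zero_left]
  have hWU : W ×ˢ U ∈ 𝓝 (pb, xb) := prod_mem_nhds hW hU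
  refine ⟨?_, ?_⟩
  · obtain ⟨κ, hκ, hsub⟩ := exists_infDist_preimage_le (g := fun x => G (pb, x)) hC hbar hg hB
      hcond'
    obtain ⟨ε₁, hε₁, hball₁⟩ := Metric.mem_nhds_iff.1 hW
    obtain ⟨ε₂, hε₂, hball₂⟩ := Metric.eventually_nhds_iff_ball.1 (hsub.and hU)
    refine ⟨κ * L', by positivity, min ε₁ ε₂, lt_min hε₁ hε₂, fun p x hp hx hxD => ?_⟩
    obtain ⟨hxsub, hxU⟩ := hball₂ x (hx.trans_le (min_le_right _ _))
    have hpW := hball₁ (show p ∈ ball pb ε₁ from hp.trans_le (min_le_left _ _))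
    refine hxsub.trans ?_
    rw [mul_assoc]
    refine mul_le_mul_of_nonneg_left ((infDist_le_dist_of_mem (s := ⋃ j, C j) hxD).trans ?_) hκ
    rw [dist_comm, dist_eq_norm, dist_eq_norm]
    exact hLip p hpW x hxU
  · rintro DG - - hDG - - - hDGc - - ⟨ut, hut, hutT⟩
    have hpart : ∀ z ∈ W ×ˢ U, HasFDerivAt (fun x => G (z.1, x))
        ((DG z).comp (ContinuousLinearMap.inr ℝ (Es l) (Es n))) z.2 := fun z hz =>
      (hDG z hz).comp z.2 (hasFDerivAt_prodMk_right z.1 z.2)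
    have hbase : (DG (pb, xb)).comp (ContinuousLinearMap.inr ℝ (Es l) (Es n)) = Gx0 xb :=
      (hpart _ (mem_of_mem_nhds hWU)).unique hg.self_of_nhds
    obtain ⟨M, hM, hev⟩ := eventually_exists_solution_near (h := fun p x => G (p, x))
      (h' := fun p x => (DG (p, x)).comp (ContinuousLinearMap.inr ℝ (Es l) (Es n)))
      hC hbar hg hB (by filter_upwards [hWU] with z hz using hpart z hz)
      (by
        rw [← hbase]
        exact (hDGc.continuousAt hWU).clm_comp continuousAt_const)
      hL'0 (by filter_upwards [hWU] with z hz using hLip z.1 hz.1 z.2 hz.2) hcond' hut hutT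
    refine ⟨_, hev, M, hM, fun p ⟨x, hxD, hx⟩ => ⟨⟨x, hxD⟩, ?_⟩⟩
    refine (infDist_le_dist_of_mem (s := {x | G (p, x) ∈ ⋃ j, C j}) hxD).trans ?_
    rwa [dist_comm, dist_eq_norm]
end
end

section
/- Let M : ℝˢ ⇒ ℝᵈ be a multifunction with closed graph and (x̄,ȳ) ∈ gph M. Then the following are equivalent: (i) (0,0) ∉ Cr₀M(x̄,ȳ); (ii) there exists r > 0 such that for every continuously differentiable h : ℝˢ → ℝᵈ with h(x̄) = 0 and ‖∇h(x̄)‖ ≤ r the mapping M + h is metrically subregular at (x̄,ȳ); (iii) for every u ≠ 0 in ℝˢ, 0 ∈ D*M((x̄,ȳ);(u,0))(v*) implies v* = 0. -/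
open Filter Topology Metric Set
open scoped RealInnerProductSpace

noncomputable section

/-- Graph of a multifunction. -/
def gph {E F : Type*} (M : E → Set F) : Set (E × F) := {z | z.2 ∈ M z.1}

/-- The canonical pairing on a product of two real inner product spaces. -/
def pr2 {E F : Type*} [NormedAddCommGroup E] [InnerProductSpace ℝ E]
    [NormedAddCommGroup F] [InnerProductSpace ℝ F] (a b : E × F) : ℝ :=
  ⟪a.1, b.1⟫ + ⟪a.2, b.2⟫

/-- The regular (Fréchet) normal cone to `A ⊆ E × F` at `z`; it is empty (by convention)
when `z ∉ A`. -/
def rnc2 {E F : Type*} [NormedAddCommGroup E] [InnerProductSpace ℝ E]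
    [NormedAddCommGroup F] [InnerProductSpace ℝ F] (A : Set (E × F)) (z : E × F) :
    Set (E × F) :=
  {zs | z ∈ A ∧ ∀ w ∈ tcone A z, pr2 zs w ≤ 0}

/-- The directional limiting normal cone to `A ⊆ E × F` at `z` in direction `w`. -/
def dnc2 {E F : Type*} [NormedAddCommGroup E] [InnerProductSpace ℝ E]
    [NormedAddCommGroup F] [InnerProductSpace ℝ F] (A : Set (E × F)) (z w : E × F) :
    Set (E × F) :=
  {zs | ∃ t : ℕ → ℝ, ∃ w' : ℕ → E × F, ∃ zs' : ℕ → E × F,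
    (∀ k, 0 < t k) ∧ Tendsto t atTop (𝓝 0) ∧ Tendsto w' atTop (𝓝 w) ∧
    Tendsto zs' atTop (𝓝 zs) ∧ ∀ k, zs' k ∈ rnc2 A (z + t k • w' k)}

/-- The limit set critical for metric subregularity `Cr₀ M (xb, yb) ⊆ ℝᵈ × ℝˢ`. -/
def Cr0 {s d : ℕ} (M : Es s → Set (Es d)) (xb : Es s) (yb : Es d) : Set (Es d × Es s) :=
  {vu | ∃ (t : ℕ → ℝ) (u : ℕ → Es s) (vsk : ℕ → Es d) (v : ℕ → Es d) (usk : ℕ → Es s),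
    (∀ k, 0 < t k) ∧ Tendsto t atTop (𝓝 0) ∧
    (∀ k, ‖u k‖ = 1) ∧ (∀ k, ‖vsk k‖ = 1) ∧
    Tendsto v atTop (𝓝 vu.1) ∧ Tendsto usk atTop (𝓝 vu.2) ∧
    ∀ k, (-usk k, vsk k) ∈ rnc2 (gph M) (xb + t k • u k, yb + t k • v k)}

section Auxiliary

variable {E F : Type*} [NormedAddCommGroup E] [InnerProductSpace ℝ E]
  [NormedAddCommGroup F] [InnerProductSpace ℝ F]

lemma continuous_pr2_right (a : E × F) : Continuous (pr2 a) := by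
  unfold pr2
  fun_prop

lemma pr2_smul_right (a b : E × F) (c : ℝ) : pr2 a (c • b) = c * pr2 a b := by
  simp only [pr2, Prod.smul_fst, Prod.smul_snd, real_inner_smul_right]
  ring

lemma pr2_smul_left (a b : E × F) (c : ℝ) : pr2 (c • a) b = c * pr2 a b := by
  simp only [pr2, Prod.smul_fst, Prod.smul_snd, real_inner_smul_left]
  ring

/-- Nonnegative multiples of regular normals are regular normals. -/
lemma smul_mem_rnc2 {A : Set (E × F)} {z zs : E × F} (h : zs ∈ rnc2 A z) {c : ℝ} (hc : 0 ≤ c) :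
    c • zs ∈ rnc2 A z :=
  ⟨h.1, fun w hw => by
    rw [pr2_smul_left]
    exact mul_nonpos_of_nonneg_of_nonpos hc (h.2 w hw)⟩

/-- In finite dimensions regular normals satisfy the Fréchet inequality. -/
lemma exists_pr2_le_of_mem_rnc2 [FiniteDimensional ℝ E] [FiniteDimensional ℝ F]
    {A : Set (E × F)} {z₀ zs : E × F} (h : zs ∈ rnc2 A z₀) {c : ℝ} (hc : 0 < c) :
    ∃ ρ : ℝ, 0 < ρ ∧ ∀ z ∈ A, ‖z - z₀‖ < ρ → pr2 zs (z - z₀) ≤ c * ‖z - z₀‖ := by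
  by_contra! hcon
  choose z hzA hzlt hz using fun n : ℕ => hcon (1 / ((n : ℝ) + 1)) Nat.one_div_pos_of_nat
  have hpos : ∀ n, 0 < ‖z n - z₀‖ := by
    intro n
    rcases (norm_nonneg (z n - z₀)).eq_or_lt with h0 | h0
    · have h1 := hz n
      rw [norm_eq_zero.1 h0.symm] at h1
      simp [pr2] at h1
    · exact h0
  have hmem : ∀ n, ‖z n - z₀‖⁻¹ • (z n - z₀) ∈ Metric.sphere (0 : E × F) 1 := by
    intro n
    simp [norm_smul, (hpos n).ne']
  obtain ⟨w, -, φ, hφ, hlim⟩ := (isCompact_sphere (0 : E × F) 1).tendsto_subseq hmem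
  have hw : w ∈ tcone A z₀ := by
    refine ⟨fun n => ‖z (φ n) - z₀‖, _, fun n => hpos _, ?_, hlim, fun n => ?_⟩
    · refine squeeze_zero (fun n => (hpos _).le) (fun n => (hzlt (φ n)).le) ?_
      exact tendsto_one_div_add_atTop_nhds_zero_nat.comp hφ.tendsto_atTop
    · simp only [Function.comp]
      rw [smul_inv_smul₀ (hpos _).ne', add_sub_cancel]
      exact hzA _
  have h1 : c ≤ pr2 zs w := by
    refine ge_of_tendsto' (((continuous_pr2_right zs).tendsto w).comp hlim) fun n => ?_
    simp only [Function.comp]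
    rw [pr2_smul_right, inv_mul_eq_div, le_div_iff₀ (hpos _)]
    exact (hz _).le
  linarith [h.2 w hw]

/-- First-order necessary condition for a minimum over a set. -/
lemma nonneg_of_mem_tcone_of_isMinOn {E : Type*} [NormedAddCommGroup E] [NormedSpace ℝ E]
    {A : Set E} {z : E} {G : E → ℝ} {G' : E →L[ℝ] ℝ} (hG : HasFDerivAt G G' z)
    (hmin : ∀ x ∈ A, G z ≤ G x) {w : E} (hw : w ∈ tcone A z) : 0 ≤ G' w := by
  obtain ⟨t, w', ht, ht0, hw', hA⟩ := hw
  have h0 : Tendsto (fun n => t n • w' n) atTop (𝓝 0) := by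
    simpa using ht0.smul hw'
  have h1 : Tendsto (fun n => (t n)⁻¹ • (t n • w' n)) atTop (𝓝 w) := by
    simpa only [inv_smul_smul₀ (ht _).ne'] using hw'
  refine ge_of_tendsto' (hG.hasFDerivWithinAt.lim (s := univ) h0 (by simp) h1) fun n => ?_
  rw [smul_eq_mul]
  exact mul_nonneg (inv_nonneg.2 (ht n).le) (sub_nonneg.2 (hmin _ (hA n)))

end Auxiliary

/-- Sequence-free description of `(0,0) ∈ Cr₀ M (xb,yb)`. -/
lemma zero_mem_Cr0_iff {s d : ℕ} {M : Es s → Set (Es d)} {xb : Es s} {yb : Es d} :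
    ((0 : Es d), (0 : Es s)) ∈ Cr0 M xb yb ↔
      ∀ δ : ℝ, 0 < δ → ∃ x y us vs, 0 < ‖x - xb‖ ∧ ‖x - xb‖ < δ ∧ ‖y - yb‖ ≤ δ * ‖x - xb‖ ∧
        ‖us‖ ≤ δ ∧ ‖vs‖ = 1 ∧ (-us, vs) ∈ rnc2 (gph M) (x, y) := by
  constructor
  · rintro ⟨t, u, vs, v, us, ht, ht0, hu, hvs, hv, hus, h⟩ δ hδ
    have hv' : ∀ᶠ k in atTop, ‖v k‖ < δ := hv.norm.eventually_lt_const (by simpa using hδ)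
    have hus' : ∀ᶠ k in atTop, ‖us k‖ < δ := hus.norm.eventually_lt_const (by simpa using hδ)
    obtain ⟨k, h1, h2, h3⟩ := ((ht0.eventually_lt_const hδ).and (hv'.and hus')).exists
    have hx : ‖xb + t k • u k - xb‖ = t k := by
      simp [norm_smul, hu, abs_of_pos (ht k)]
    refine ⟨_, _, us k, vs k, ?_, ?_, ?_, h3.le, hvs k, h k⟩
    · rw [hx]; exact ht k
    · rw [hx]; exact h1
    · rw [hx, add_sub_cancel_left, norm_smul, Real.norm_of_nonneg (ht k).le, mul_comm]
      exact mul_le_mul_of_nonneg_right h2.le (ht k).le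
  · intro h
    choose x y us vs hx0 hx hy hus hvs hn using
      fun n : ℕ => h (1 / ((n : ℝ) + 1)) Nat.one_div_pos_of_nat
    have hlim := tendsto_one_div_add_atTop_nhds_zero_nat (𝕜 := ℝ)
    refine ⟨fun n => ‖x n - xb‖, fun n => ‖x n - xb‖⁻¹ • (x n - xb), vs,
      fun n => ‖x n - xb‖⁻¹ • (y n - yb), us, hx0,
      squeeze_zero (fun n => (hx0 n).le) (fun n => (hx n).le) hlim, fun n => ?_, hvs, ?_,
      squeeze_zero_norm hus hlim, fun n => ?_⟩
    · simp [norm_smul, (hx0 n).ne']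
    · refine squeeze_zero_norm (fun n => ?_) hlim
      rw [norm_smul, norm_inv, norm_norm, inv_mul_le_iff₀ (hx0 n), mul_comm]
      exact hy n
    · simp only [smul_inv_smul₀ (hx0 n).ne', add_sub_cancel]
      exact hn n

/-- `(0,0) ∉ Cr₀ M (xb,yb)` in terms of directional limiting coderivatives. -/
lemma zero_notMem_Cr0_iff_coderivative {s d : ℕ} {M : Es s → Set (Es d)} {xb : Es s} {yb : Es d} :
    ((0 : Es d), (0 : Es s)) ∉ Cr0 M xb yb ↔
      ∀ u : Es s, u ≠ 0 → ∀ vs : Es d,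
        ((0 : Es s), -vs) ∈ dnc2 (gph M) (xb, yb) (u, 0) → vs = 0 := by
  constructor
  · rintro h u hu vs ⟨t, w, zs, ht, ht0, hw, hzs, hn⟩
    by_contra hvs
    refine h (zero_mem_Cr0_iff.2 fun δ hδ => ?_)
    have hw1 : Tendsto (fun k => ‖(w k).1‖) atTop (𝓝 ‖u‖) := (hw.fst_nhds).norm
    have hw2 : Tendsto (fun k => ‖(w k).2‖) atTop (𝓝 0) := by
      simpa using (hw.snd_nhds).norm
    have hz1 : Tendsto (fun k => ‖(zs k).1‖) atTop (𝓝 0) := by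
      simpa using (hzs.fst_nhds).norm
    have hz2 : Tendsto (fun k => ‖(zs k).2‖) atTop (𝓝 ‖vs‖) := by
      simpa using (hzs.snd_nhds).norm
    have hu' := norm_pos_iff.2 hu
    have hvs' := norm_pos_iff.2 hvs
    have e1 : ∀ᶠ k in atTop, 0 < ‖(w k).1‖ := hw1.eventually_const_lt hu'
    have e2 : ∀ᶠ k in atTop, 0 < ‖(zs k).2‖ := hz2.eventually_const_lt hvs'
    have e3 : ∀ᶠ k in atTop, t k * ‖(w k).1‖ < δ :=
      (ht0.mul hw1).eventually_lt_const (by simpa using hδ)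
    have e4 : ∀ᶠ k in atTop, ‖(w k).2‖ < δ * ‖(w k).1‖ :=
      hw2.eventually_lt (hw1.const_mul δ) (by positivity)
    have e5 : ∀ᶠ k in atTop, ‖(zs k).1‖ < δ * ‖(zs k).2‖ :=
      hz1.eventually_lt (hz2.const_mul δ) (by positivity)
    obtain ⟨k, h1, h2, h3, h4, h5⟩ := (e1.and (e2.and (e3.and (e4.and e5)))).exists
    have hx : ‖xb + t k • (w k).1 - xb‖ = t k * ‖(w k).1‖ := by
      simp [norm_smul, abs_of_pos (ht k)]
    refine ⟨xb + t k • (w k).1, yb + t k • (w k).2, -(‖(zs k).2‖⁻¹ • (zs k).1),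
      ‖(zs k).2‖⁻¹ • (zs k).2, ?_, ?_, ?_, ?_, ?_, ?_⟩
    · rw [hx]; exact mul_pos (ht k) h1
    · rw [hx]; exact h3
    · rw [hx, add_sub_cancel_left, norm_smul, Real.norm_of_nonneg (ht k).le]
      nlinarith [mul_le_mul_of_nonneg_left h4.le (ht k).le]
    · rw [norm_neg, norm_smul, norm_inv, norm_norm, inv_mul_le_iff₀ h2, mul_comm]
      exact h5.le
    · simp [norm_smul, h2.ne']
    · rw [neg_neg]
      exact smul_mem_rnc2 (hn k) (inv_nonneg.2 h2.le)
  · rintro h ⟨t, u, vs, v, us, ht, ht0, hu, hvs, hv, hus, hn⟩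
    obtain ⟨⟨u₀, v₀⟩, hmem, φ, hφ, hlim⟩ :=
      ((isCompact_sphere (0 : Es s) 1).prod (isCompact_sphere (0 : Es d) 1)).tendsto_subseq
        (x := fun k => (u k, vs k)) (fun k => by simp [hu, hvs])
    simp only [mem_prod, mem_sphere_iff_norm, sub_zero] at hmem
    have hφ' := hφ.tendsto_atTop
    have : -v₀ = 0 := by
      refine h u₀ (norm_ne_zero_iff.1 (by simp [hmem.1])) (-v₀)
        ⟨t ∘ φ, fun k => (u (φ k), v (φ k)), fun k => (-us (φ k), vs (φ k)), fun k => ht _,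
          ht0.comp hφ', hlim.fst_nhds.prodMk_nhds (hv.comp hφ'), ?_, fun k => hn _⟩
      have h0 : Tendsto (fun k => -us (φ k)) atTop (𝓝 0) := by
        simpa using (hus.comp hφ').neg
      rw [neg_neg]
      exact h0.prodMk_nhds hlim.snd_nhds
    simp [neg_eq_zero.1 this] at hmem

/-- A distance bound controlling `h` near `xb` when `h xb = 0` and `‖h' xb‖ < c`. -/
lemma exists_forall_norm_le_of_fderiv_lt {E F : Type*} [NormedAddCommGroup E] [NormedSpace ℝ E]
    [NormedAddCommGroup F] [NormedSpace ℝ F] {h : E → F} {xb : E} (hh : ContDiff ℝ 1 h)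
    (h0 : h xb = 0) {c : ℝ} (hc : ‖fderiv ℝ h xb‖ < c) :
    ∃ ε : ℝ, 0 < ε ∧ ∀ x, ‖x - xb‖ < ε → ‖fderiv ℝ h x‖ ≤ c ∧ ‖h x‖ ≤ c * ‖x - xb‖ := by
  have hcont : Continuous fun x => ‖fderiv ℝ h x‖ := (hh.continuous_fderiv one_ne_zero).norm
  obtain ⟨ε, hε, hball⟩ := Metric.eventually_nhds_iff_ball.1
    (hcont.continuousAt.eventually_lt_const hc)
  refine ⟨ε, hε, fun x hx => ?_⟩
  have hx' : x ∈ Metric.ball xb ε := mem_ball_iff_norm.2 hx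
  refine ⟨(hball x hx').le, ?_⟩
  simpa [h0] using (convex_ball xb ε).norm_image_sub_le_of_norm_fderiv_le
    (fun z _ => (hh.differentiable one_ne_zero) z) (fun z hz => (hball z hz).le)
    (mem_ball_self hε) hx'

/-- If regular normals `(-us, vs)` with `‖vs‖ = 1` at points close to `(xb, yb)` in directions
`(u, v)` with small `v` have `us` bounded away from zero, then `M` is stably subregular. -/
lemma metrSubregAt_add_of_lt_norm {s d : ℕ} {M : Es s → Set (Es d)} {xb : Es s} {yb : Es d}
    (hcl : IsClosed (gph M)) (hbar : yb ∈ M xb) {δ : ℝ} (hδ : 0 < δ)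
    (hn : ∀ x y us vs, 0 < ‖x - xb‖ → ‖x - xb‖ < δ → ‖y - yb‖ ≤ δ * ‖x - xb‖ → ‖us‖ ≤ δ →
      ‖vs‖ = 1 → (-us, vs) ∉ rnc2 (gph M) (x, y))
    {h : Es s → Es d} (hh : ContDiff ℝ 1 h) (h0 : h xb = 0) (hd : ‖fderiv ℝ h xb‖ ≤ δ / 4) :
    MetrSubregAt (fun x => (fun y => h x + y) '' M x) xb yb := by
  obtain ⟨ε, hε, hhε⟩ := exists_forall_norm_le_of_fderiv_lt hh h0
    (show ‖fderiv ℝ h xb‖ < δ / 2 by linarith)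
  have hκ : 0 < 8 / δ := by positivity
  refine ⟨8 / δ, hκ.le, min ε δ / 2, by positivity, fun x₀ hx₀ => ?_⟩
  rw [dist_eq_norm] at hx₀
  by_contra! hlt
  set S : Set (Es s) := {x' | yb ∈ (fun y => h x' + y) '' M x'} with hS
  have hxbS : xb ∈ S := ⟨yb, hbar, by simp [h0]⟩
  have hDlt : Metric.infEDist x₀ S ≠ ⊤ := Metric.infEDist_ne_top ⟨_, hxbS⟩
  set D := Metric.infDist x₀ S with hD
  have hDS : Metric.infEDist x₀ S = ENNReal.ofReal D := (ENNReal.ofReal_toReal hDlt).symm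
  have hDle : D ≤ ‖x₀ - xb‖ := by
    rw [← dist_eq_norm]; exact Metric.infDist_le_dist_of_mem hxbS
  obtain ⟨y₀, hy₀, he⟩ : ∃ y₀ ∈ M x₀, 8 / δ * ‖h x₀ + y₀ - yb‖ < D := by
    change ENNReal.ofReal (8 / δ) * Metric.infEDist yb _ < Metric.infEDist x₀ S at hlt
    rw [mul_comm, ← ENNReal.lt_div_iff_mul_lt (by simp [hκ]) (by simp),
      Metric.infEDist_lt_iff] at hlt
    obtain ⟨_, ⟨y₀, hy₀, rfl⟩, hlt⟩ := hlt
    refine ⟨y₀, hy₀, ?_⟩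
    rw [ENNReal.lt_div_iff_mul_lt (by simp [hκ]) (by simp), hDS, edist_comm, edist_dist,
      ← ENNReal.ofReal_mul dist_nonneg, dist_eq_norm] at hlt
    rw [mul_comm]
    exact (ENNReal.ofReal_lt_ofReal_iff_of_nonneg (by positivity)).1 hlt
  set e := ‖h x₀ + y₀ - yb‖ with he_def
  have hD0 : 0 < D := lt_of_le_of_lt (by positivity) he
  have hSD : ∀ x ∈ S, D ≤ ‖x - x₀‖ := fun x hx => by
    rw [norm_sub_rev, ← dist_eq_norm]; exact Metric.infDist_le_dist_of_mem hx
  have hx₀S : x₀ ∉ S := fun hx => by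
    have := hSD _ hx
    simp at this
    linarith
  have he0 : 0 < e := by
    refine norm_pos_iff.2 fun h1 => hx₀S ⟨y₀, hy₀, sub_eq_zero.1 h1⟩
  have heD : e < δ / 8 * D := by
    rw [div_mul_eq_mul_div, div_lt_iff₀ hδ] at he
    linarith
  -- minimise a smooth penalisation of the residual over the graph
  set β := e / (D / 2) ^ 2 with hβ
  have hβ0 : 0 < β := by positivity
  let G : Es s × Es d → ℝ := fun z => ‖h z.1 + z.2 - yb‖ + β * ‖z.1 - x₀‖ ^ 2
  have hhc : Continuous h := hh.continuous
  have hGc : Continuous G := by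
    change Continuous fun z : Es s × Es d => ‖h z.1 + z.2 - yb‖ + β * ‖z.1 - x₀‖ ^ 2
    fun_prop
  have hG0 : G (x₀, y₀) = e := by simp [G, he_def]
  have hsub : ∀ z, G z ≤ e → ‖z.1 - x₀‖ ≤ D / 2 ∧ ‖h z.1 + z.2 - yb‖ ≤ e := by
    intro z hz
    have h1 : 0 ≤ ‖h z.1 + z.2 - yb‖ := norm_nonneg _
    have h2 : 0 ≤ β * ‖z.1 - x₀‖ ^ 2 := by positivity
    change ‖h z.1 + z.2 - yb‖ + β * ‖z.1 - x₀‖ ^ 2 ≤ e at hz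
    refine ⟨?_, by linarith⟩
    have h3 : β * ‖z.1 - x₀‖ ^ 2 ≤ e := by linarith
    rw [hβ, div_mul_eq_mul_div, div_le_iff₀ (by positivity)] at h3
    exact le_of_sq_le_sq (le_of_mul_le_mul_left h3 he0) (by positivity)
  have hnear : ∀ x, ‖x - x₀‖ ≤ D / 2 → ‖x - xb‖ < min ε δ ∧ ‖x₀ - xb‖ ≤ 2 * ‖x - xb‖ := by
    intro x hx
    have h1 := norm_sub_le_norm_sub_add_norm_sub x x₀ xb
    have h2 := norm_sub_le_norm_sub_add_norm_sub x₀ x xb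
    rw [norm_sub_rev x₀ x] at h2
    constructor <;> linarith
  have hK : IsCompact (gph M ∩ {z | G z ≤ e}) := by
    refine Metric.isCompact_of_isClosed_isBounded
      (hcl.inter (isClosed_le hGc continuous_const)) ?_
    refine ((Metric.isBounded_closedBall (x := x₀) (r := D / 2)).prod
      (Metric.isBounded_closedBall (x := yb) (r := e + δ / 2 * min ε δ))).subset ?_
    rintro z ⟨-, hz⟩
    obtain ⟨h1, h2⟩ := hsub z hz
    obtain ⟨h3, -⟩ := hnear _ h1
    refine ⟨mem_closedBall_iff_norm.2 h1, mem_closedBall_iff_norm.2 ?_⟩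
    have h4 := (hhε z.1 (h3.trans_le (min_le_left _ _))).2
    have h5 : z.2 - yb = (h z.1 + z.2 - yb) - h z.1 := by abel
    rw [h5]
    refine (norm_sub_le _ _).trans (add_le_add h2 (h4.trans ?_))
    exact mul_le_mul_of_nonneg_left h3.le (by positivity)
  obtain ⟨⟨x, y⟩, ⟨hzM, hze⟩, hmin⟩ := hK.exists_isMinOn
    ⟨(x₀, y₀), hy₀, hG0.le⟩ hGc.continuousOn
  have hmin' : ∀ z ∈ gph M, G (x, y) ≤ G z := by
    intro z hz
    by_cases hz' : G z ≤ e
    · exact hmin ⟨hz, hz'⟩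
    · exact le_trans hze (not_le.1 hz').le
  obtain ⟨h1, h2⟩ := hsub _ hze
  obtain ⟨h3, h4⟩ := hnear _ h1
  obtain ⟨h5, h6⟩ := hhε x (h3.trans_le (min_le_left _ _))
  simp only at h1 h2 h3 h4
  set a := h x + y - yb with ha
  have ha0 : 0 < ‖a‖ := by
    refine norm_pos_iff.2 fun h1' => ?_
    have := hSD x ⟨y, hzM, sub_eq_zero.1 h1'⟩
    linarith
  have hx0 : 0 < ‖x - xb‖ := by linarith
  set v := ‖a‖⁻¹ • a with hv
  have hv1 : ‖v‖ = 1 := by simp [hv, norm_smul, ha0.ne']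
  refine hn x y ((fderiv ℝ h x).adjoint v + (2 * β) • (x - x₀)) (-v) hx0
    (h3.trans_le (min_le_right _ _)) ?_ ?_ (by rw [norm_neg, hv1]) ⟨hzM, fun w hw => ?_⟩
  · have h7 : y - yb = a - h x := by rw [ha]; abel
    rw [h7]
    refine (norm_sub_le _ _).trans ?_
    nlinarith
  · refine (norm_add_le _ _).trans ?_
    have h7 : ‖(fderiv ℝ h x).adjoint v‖ ≤ δ / 2 := by
      refine ((fderiv ℝ h x).adjoint.le_opNorm v).trans ?_
      rw [hv1, mul_one, LinearIsometryEquiv.norm_map]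
      exact h5
    have h8 : ‖(2 * β) • (x - x₀)‖ ≤ δ / 2 := by
      rw [norm_smul, Real.norm_of_nonneg (by positivity)]
      calc 2 * β * ‖x - x₀‖ ≤ 2 * β * (D / 2) := by gcongr
        _ = 4 * e / D := by rw [hβ]; field_simp; ring
        _ ≤ δ / 2 := by rw [div_le_iff₀ hD0]; linarith
    linarith
  · have hA : HasFDerivAt (fun z : Es s × Es d => h z.1 + z.2 - yb)
        ((fderiv ℝ h x).comp (ContinuousLinearMap.fst ℝ _ _) + ContinuousLinearMap.snd ℝ _ _)
        (x, y) := by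
      have h7 : HasFDerivAt h (fderiv ℝ h x) x := (hh.differentiable one_ne_zero x).hasFDerivAt
      exact ((HasFDerivAt.comp (x, y) (g := h) h7 hasFDerivAt_fst).add hasFDerivAt_snd).sub_const yb
    have hB : HasFDerivAt (fun z : Es s × Es d => z.1 - x₀) (ContinuousLinearMap.fst ℝ _ _)
        (x, y) := hasFDerivAt_fst.sub_const x₀
    have hA' := hA.norm_sq.sqrt (show ‖a‖ ^ 2 ≠ 0 by positivity)
    simp only [Real.sqrt_sq (norm_nonneg _)] at hA'
    have hG' := hA'.add (hB.norm_sq.const_mul β)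
    have key := nonneg_of_mem_tcone_of_isMinOn hG' hmin' hw
    simp only [← ha, pr2, inner_neg_left, inner_add_left, ContinuousLinearMap.adjoint_inner_left,
      real_inner_smul_left, hv] at key ⊢
    simp at key
    rw [inner_sub_left x x₀ w.1]
    linarith

lemma hasFDerivAt_sqrt_norm_sub_sq {E : Type*} [NormedAddCommGroup E] [InnerProductSpace ℝ E]
    (x₀ x : E) {η : ℝ} (hη : 0 < η) :
    ∃ L : E →L[ℝ] ℝ, HasFDerivAt (fun x => √(‖x - x₀‖ ^ 2 + η ^ 2)) L x ∧ ‖L‖ ≤ 1 := by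
  have h1 : HasFDerivAt (fun x : E => x - x₀) (ContinuousLinearMap.id ℝ E) x :=
    (hasFDerivAt_id x).sub_const x₀
  have h2 : 0 < ‖x - x₀‖ ^ 2 + η ^ 2 := by positivity
  refine ⟨_, (h1.norm_sq.add_const (η ^ 2)).sqrt h2.ne', ?_⟩
  have h3 : ‖x - x₀‖ ≤ √(‖x - x₀‖ ^ 2 + η ^ 2) := Real.le_sqrt_of_sq_le (by nlinarith)
  have h4 : 0 < √(‖x - x₀‖ ^ 2 + η ^ 2) := Real.sqrt_pos.2 h2
  refine ContinuousLinearMap.opNorm_le_bound _ zero_le_one fun w => ?_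
  have h5 := abs_real_inner_le_norm (x - x₀) w
  have h6 : ∀ S : ℝ, 0 < S → ‖x - x₀‖ ≤ S →
      ‖((1 / (2 * S)) • 2 • (innerSL ℝ (x - x₀)).comp (ContinuousLinearMap.id ℝ E)) w‖
        ≤ 1 * ‖w‖ := by
    intro S hS hxS
    have : ((1 / (2 * S)) • 2 • (innerSL ℝ (x - x₀)).comp (ContinuousLinearMap.id ℝ E)) w
        = ⟪x - x₀, w⟫ / S := by
      simp only [ContinuousLinearMap.comp_id, smul_apply, innerSL_apply_apply,
        smul_eq_mul, nsmul_eq_mul]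
      push_cast
      field_simp
    rw [this, norm_div, Real.norm_eq_abs, Real.norm_of_nonneg hS.le, div_le_iff₀ hS, one_mul]
    refine h5.trans ?_
    rw [mul_comm]
    gcongr
  exact h6 _ h4 h3

/-- Near a point of the graph with an almost vertical regular normal there is a small bump
perturbation destroying subregularity with any prescribed modulus. -/
lemma exists_bump_perturbation {s d : ℕ} {M : Es s → Set (Es d)} {xb : Es s} {yb : Es d}
    (h0 : ((0 : Es d), (0 : Es s)) ∈ Cr0 M xb yb) {δ : ℝ} (hδ : 0 < δ) :
    ∃ (x₀ : Es s) (f : Es s → Es d), 0 < ‖x₀ - xb‖ ∧ ‖x₀ - xb‖ < δ ∧ ContDiff ℝ 1 f ∧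
      (∀ x, ‖x₀ - xb‖ / 2 < ‖x - x₀‖ → f x = 0) ∧ (∀ x, ‖f x‖ ≤ δ) ∧
      (∀ x, ‖fderiv ℝ f x‖ ≤ δ) ∧
      ∃ ρ : ℝ, 0 < ρ ∧ ρ ≤ ‖x₀ - xb‖ / 4 ∧
        (∀ x, ‖x - x₀‖ < ρ → ∀ y ∈ M x, f x + y ≠ yb) ∧
        ∃ y ∈ M x₀, ‖f x₀ + y - yb‖ ≤ δ * ρ := by
  let φ : ContDiffBump (0 : Es s) := ⟨1 / 4, 1 / 2, by norm_num, by norm_num⟩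
  have hφd : ContDiff ℝ 1 φ := φ.contDiff
  obtain ⟨C, hC⟩ : ∃ C, ∀ x, ‖fderiv ℝ φ x‖ ≤ C :=
    (hφd.continuous_fderiv one_ne_zero).bounded_above_of_compact_support
      (φ.hasCompactSupport.fderiv (𝕜 := ℝ))
  have hC0 : 0 ≤ C := (norm_nonneg _).trans (hC 0)
  obtain ⟨ε, hε, hε1, hεδ⟩ : ∃ ε : ℝ, 0 < ε ∧ ε ≤ 1 ∧ (4 * C + 4) * ε ≤ δ := by
    refine ⟨min 1 (δ / (4 * C + 4)), by positivity, min_le_left _ _, ?_⟩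
    rw [← le_div_iff₀' (by positivity)]
    exact min_le_right _ _
  have hεδ' : ε ≤ δ := by nlinarith
  obtain ⟨x₀, y₀, us, vs, ht, htε, hy₀, hus, hvs, hn⟩ := zero_mem_Cr0_iff.1 h0 ε hε
  obtain ⟨r, hr, hrn⟩ := exists_pr2_le_of_mem_rnc2 hn (c := ε / 4) (by positivity)
  set t := ‖x₀ - xb‖ with ht_def
  set ρ := min (r / 8) (t / 4) with hρ_def
  have hρ : 0 < ρ := by positivity
  have hρr : ρ ≤ r / 8 := min_le_left _ _
  have hρt : ρ ≤ t / 4 := min_le_right _ _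
  let S : Es s → ℝ := fun x => √(‖x - x₀‖ ^ 2 + ρ ^ 2)
  have hSn : ∀ x, ‖x - x₀‖ ≤ S x := fun x => Real.le_sqrt_of_sq_le (by nlinarith)
  have hS0 : ∀ x, 0 < S x := fun x => Real.sqrt_pos.2 (by positivity)
  have hSle : ∀ x, S x ≤ ‖x - x₀‖ + ρ := fun x =>
    Real.sqrt_le_iff.2 ⟨by positivity, by nlinarith [norm_nonneg (x - x₀)]⟩
  have hSx₀ : S x₀ = ρ := by simp [S, Real.sqrt_sq hρ.le]
  have hSd : ContDiff ℝ 1 S :=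
    (((contDiff_id.sub contDiff_const).norm_sq ℝ).add contDiff_const).sqrt
      fun x => by simp only [id]; positivity
  let θ : Es s → ℝ := fun x => ⟪us, x - x₀⟫ + ε * S x
  have hθd : ContDiff ℝ 1 θ :=
    (contDiff_const.inner ℝ (contDiff_id.sub contDiff_const)).add (contDiff_const.mul hSd)
  have hθ : ∀ x, |θ x| ≤ ε * ‖x - x₀‖ + ε * S x := by
    intro x
    refine (abs_add_le _ _).trans (add_le_add ?_ ?_)
    · exact (abs_real_inner_le_norm _ _).trans (by gcongr)
    · rw [abs_of_pos (mul_pos hε (hS0 x))]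
  have hθ' : ∀ x, ‖fderiv ℝ θ x‖ ≤ 2 * ε := by
    intro x
    obtain ⟨L, hL, hL1⟩ := hasFDerivAt_sqrt_norm_sub_sq x₀ x hρ
    have h1 : HasFDerivAt (fun x : Es s => x - x₀) (ContinuousLinearMap.id ℝ _) x :=
      (hasFDerivAt_id x).sub_const x₀
    have h2 : HasFDerivAt θ ((innerSL ℝ us).comp (ContinuousLinearMap.id ℝ _) + ε • L) x :=
      (HasFDerivAt.comp x (g := innerSL ℝ us) (innerSL ℝ us).hasFDerivAt h1).add
        (hL.const_mul ε)
    rw [h2.fderiv, ContinuousLinearMap.comp_id]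
    refine (norm_add_le _ _).trans ?_
    rw [innerSL_apply_norm, norm_smul, Real.norm_of_nonneg hε.le]
    nlinarith
  let g : Es s → Es d := fun x => yb - y₀ - θ x • vs
  have hgd : ContDiff ℝ 1 g := contDiff_const.sub (hθd.smul contDiff_const)
  have hg : ∀ x, ‖x - x₀‖ ≤ t → ‖g x‖ ≤ 4 * ε * t := by
    intro x hx
    refine (norm_sub_le _ _).trans ?_
    rw [norm_smul, hvs, mul_one, norm_sub_rev, Real.norm_eq_abs]
    have h1 := hθ x
    have h2 := hSle x
    nlinarith
  have hg' : ∀ x, ‖fderiv ℝ g x‖ ≤ 2 * ε := by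
    intro x
    have h1 : HasFDerivAt g (-(fderiv ℝ θ x).smulRight vs) x :=
      ((hθd.differentiable one_ne_zero x).hasFDerivAt.smul_const vs).const_sub _
    rw [h1.fderiv, norm_neg, ContinuousLinearMap.norm_smulRight_apply, hvs, mul_one]
    exact hθ' x
  let ψ : Es s → ℝ := fun x => φ (t⁻¹ • (x - x₀))
  have hψd : ContDiff ℝ 1 ψ := hφd.comp ((contDiff_id.sub contDiff_const).const_smul _)
  have hψ1 : ∀ x, ‖x - x₀‖ ≤ t / 4 → ψ x = 1 := by
    intro x hx
    refine φ.one_of_mem_closedBall ?_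
    rw [mem_closedBall_zero_iff, norm_smul, norm_inv, Real.norm_of_nonneg ht.le,
      inv_mul_le_iff₀ ht]
    change _ ≤ t * (1 / 4)
    linarith
  have hψ0 : ∀ x, t / 2 < ‖x - x₀‖ → ψ x = 0 := by
    intro x hx
    refine φ.zero_of_le_dist ?_
    rw [dist_zero_right, norm_smul, norm_inv, Real.norm_of_nonneg ht.le, le_inv_mul_iff₀ ht]
    change t * (1 / 2) ≤ _
    linarith
  have hψ' : ∀ x, ‖fderiv ℝ ψ x‖ ≤ C / t := by
    intro x
    have h1 : HasFDerivAt (fun x : Es s => t⁻¹ • (x - x₀))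
        (t⁻¹ • ContinuousLinearMap.id ℝ (Es s)) x :=
      ((hasFDerivAt_id x).sub_const x₀).const_smul t⁻¹
    have h2 : HasFDerivAt ψ _ x :=
      HasFDerivAt.comp x (g := φ) (hφd.differentiable one_ne_zero _).hasFDerivAt h1
    rw [h2.fderiv, ContinuousLinearMap.comp_smul, ContinuousLinearMap.comp_id, norm_smul,
      norm_inv, Real.norm_of_nonneg ht.le, div_eq_inv_mul]
    gcongr
    exact hC _
  have hψle : ∀ x, ‖ψ x‖ ≤ 1 := fun x => by
    rw [Real.norm_of_nonneg φ.nonneg]; exact φ.le_one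
  have hf0 : ∀ x, t / 2 < ‖x - x₀‖ → ψ x • g x = 0 := fun x hx => by rw [hψ0 x hx, zero_smul]
  refine ⟨x₀, fun x => ψ x • g x, ht, htε.trans_le hεδ', hψd.smul hgd, hf0, fun x => ?_,
    fun x => ?_, ρ, hρ, hρt, fun x hx y hy hxy => ?_, y₀, hn.1, ?_⟩
  · beta_reduce
    rcases lt_or_ge (t / 2) ‖x - x₀‖ with hx | hx
    · rw [hf0 x hx, norm_zero]; exact hδ.le
    · rw [norm_smul]
      have h1 := hg x (by linarith)
      have h2 := hψle x
      have h3 := norm_nonneg (g x)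
      have h4 : ‖ψ x‖ * ‖g x‖ ≤ 1 * ‖g x‖ := by gcongr
      have h5 : 4 * ε * t ≤ 4 * ε := by nlinarith
      nlinarith
  · rcases lt_or_ge (t / 2) ‖x - x₀‖ with hx | hx
    · have h1 : (fun x => ψ x • g x) =ᶠ[𝓝 x] fun _ => 0 := by
        have h2 : Continuous fun x : Es s => ‖x - x₀‖ := by fun_prop
        filter_upwards [h2.continuousAt.eventually_const_lt hx] with z hz using hf0 z hz
      rw [h1.fderiv_eq, fderiv_fun_const]
      simpa using hδ.le
    · have h1 := (hψd.differentiable one_ne_zero x).hasFDerivAt.smul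
        (hgd.differentiable one_ne_zero x).hasFDerivAt
      have h1' : HasFDerivAt (fun x => ψ x • g x) _ x := h1
      rw [h1'.fderiv]
      refine (norm_add_le _ _).trans ?_
      rw [norm_smul, ContinuousLinearMap.norm_smulRight_apply]
      have h2 : ‖ψ x‖ * ‖fderiv ℝ g x‖ ≤ 1 * (2 * ε) :=
        mul_le_mul (hψle x) (hg' x) (norm_nonneg _) zero_le_one
      have h3 : ‖fderiv ℝ ψ x‖ * ‖g x‖ ≤ C / t * (4 * ε * t) :=
        mul_le_mul (hψ' x) (hg x (by linarith)) (norm_nonneg _) (by positivity)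
      have h4 : C / t * (4 * ε * t) = 4 * C * ε := by field_simp
      linarith
  · have hfx : ψ x • g x = yb - y₀ - θ x • vs := by
      rw [hψ1 x (by linarith), one_smul]
    have hy' : y = y₀ + θ x • vs := by
      have h1 : y = yb - ψ x • g x := eq_sub_of_add_eq' hxy
      rw [h1, hfx]
      abel
    have hdiff : (x, y) - (x₀, y₀) = (x - x₀, θ x • vs) := by
      rw [Prod.mk_sub_mk, hy', add_sub_cancel_left]
    have h1 := hθ x
    have h2 := hSle x
    have h3 := hSn x
    have h4 := hS0 x
    have hnorm : ‖(x, y) - (x₀, y₀)‖ ≤ 2 * S x := by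
      rw [hdiff, Prod.norm_mk, norm_smul, hvs, mul_one, Real.norm_eq_abs]
      refine max_le (by linarith) ?_
      nlinarith
    have h5 := hrn (x, y) hy (by linarith)
    have h6 : pr2 (-us, vs) ((x, y) - (x₀, y₀)) = ε * S x := by
      rw [hdiff, pr2]
      simp only [inner_neg_left, real_inner_smul_right, real_inner_self_eq_norm_sq, hvs, θ]
      ring
    rw [h6] at h5
    have h7 : ε / 4 * ‖(x, y) - (x₀, y₀)‖ ≤ ε / 4 * (2 * S x) := by gcongr
    nlinarith [mul_pos hε h4]
  · have h1 : ψ x₀ • g x₀ + y₀ - yb = -((ε * ρ) • vs) := by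
      rw [hψ1 x₀ (by simp; positivity), one_smul]
      simp only [g, θ, sub_self, inner_zero_right, hSx₀, zero_add]
      abel
    rw [h1, norm_neg, norm_smul, hvs, mul_one, Real.norm_of_nonneg (by positivity)]
    gcongr

/-- If `(0,0) ∈ Cr₀ M (xb,yb)`, then a `C¹` perturbation vanishing to first order destroys metric
subregularity. -/
lemma exists_not_metrSubregAt_add {s d : ℕ} {M : Es s → Set (Es d)} {xb : Es s} {yb : Es d}
    (h0 : ((0 : Es d), (0 : Es s)) ∈ Cr0 M xb yb) :
    ∃ h : Es s → Es d, ContDiff ℝ 1 h ∧ h xb = 0 ∧ fderiv ℝ h xb = 0 ∧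
      ¬ MetrSubregAt (fun x => (fun y => h x + y) '' M x) xb yb := by
  choose! p f hp hpδ hfd hfs hfn hfn' ρ hρ hρp hbad y hyM hy using
    fun (δ : ℝ) (hδ : 0 < δ) => exists_bump_perturbation h0 hδ
  obtain ⟨δ, hδ, hδdec⟩ := exists_seq_of_forall_finset_exists
    (fun δ : ℝ => 0 < δ ∧ δ ≤ 1) (fun a b => b ≤ ‖p a - xb‖ / 4 ∧ b ≤ a / 2) (fun A hA => by
      obtain ⟨b, hb⟩ : ∃ b : ℝ, 0 < b ∧ b ≤ 1 ∧ ∀ a ∈ A, b ≤ ‖p a - xb‖ / 4 ∧ b ≤ a / 2 := by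
        have h1 : ∀ᶠ b : ℝ in 𝓝[>] 0, ∀ a ∈ A, b ≤ ‖p a - xb‖ / 4 ∧ b ≤ a / 2 := by
          rw [Filter.eventually_all_finset]
          intro a ha
          have h2 := hp a (hA a ha).1
          have h3 := (hA a ha).1
          filter_upwards [Ioo_mem_nhdsGT (show (0 : ℝ) < ‖p a - xb‖ / 4 by positivity),
            Ioo_mem_nhdsGT (show (0 : ℝ) < a / 2 by positivity)] with b hb hb'
          exact ⟨hb.2.le, hb'.2.le⟩
        obtain ⟨b, hb, hb'⟩ := (h1.and (Ioo_mem_nhdsGT (zero_lt_one (α := ℝ)))).exists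
        exact ⟨b, hb'.1, hb'.2.le, hb⟩
      exact ⟨b, ⟨hb.1, hb.2.1⟩, hb.2.2⟩)
  have hδ0 : ∀ n, 0 < δ n := fun n => (hδ n).1
  have hδle : ∀ n, δ n ≤ (1 / 2 : ℝ) ^ n := by
    intro n
    induction n with
    | zero => simpa using (hδ 0).2
    | succ n ih =>
      have := (hδdec n (n + 1) n.lt_succ_self).2
      rw [pow_succ]
      linarith
  have hsum : Summable fun n : ℕ => (1 / 2 : ℝ) ^ n := summable_geometric_two
  have hδlim : Tendsto δ atTop (𝓝 0) :=
    squeeze_zero (fun n => (hδ0 n).le) hδle hsum.tendsto_atTop_zero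
  have hvanish : ∀ m n, m ≠ n → ∀ x, ‖x - p (δ n)‖ ≤ ‖p (δ n) - xb‖ / 4 → f (δ m) x = 0 := by
    intro m n hmn x hx
    refine hfs _ (hδ0 m) x ?_
    have h1 := hp _ (hδ0 n)
    have h1' := hp _ (hδ0 m)
    have h2 := norm_sub_le_norm_sub_add_norm_sub (p (δ m)) x xb
    have h3 := norm_sub_le_norm_sub_add_norm_sub x (p (δ n)) xb
    have h4 := norm_sub_le_norm_sub_add_norm_sub (p (δ n)) x xb
    have h5 := norm_sub_le_norm_sub_add_norm_sub x (p (δ m)) xb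
    rw [norm_sub_rev _ x] at h2 h4
    rcases lt_or_gt_of_ne hmn with hlt | hlt
    · have h6 := (hδdec m n hlt).1
      have h7 := hpδ _ (hδ0 n)
      linarith
    · have h6 := (hδdec n m hlt).1
      have h7 := hpδ _ (hδ0 m)
      linarith
  have hxb : ∀ n x, ‖x - xb‖ < ‖p (δ n) - xb‖ / 2 → f (δ n) x = 0 := by
    intro n x hx
    refine hfs _ (hδ0 n) x ?_
    have h2 := norm_sub_le_norm_sub_add_norm_sub (p (δ n)) x xb
    rw [norm_sub_rev _ x] at h2
    linarith
  have hxb0 : ∀ n, f (δ n) xb = 0 := fun n =>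
    hxb n xb (by simpa using hp _ (hδ0 n))
  set h : Es s → Es d := fun x => ∑' n, f (δ n) x with hh
  have hloc : ∀ n x, ‖x - p (δ n)‖ ≤ ‖p (δ n) - xb‖ / 4 → h x = f (δ n) x := fun n x hx =>
    tsum_eq_single n fun m hm => hvanish m n hm x hx
  refine ⟨h, ?_, ?_, ?_, ?_⟩
  · refine contDiff_tsum (v := fun _ n => (1 / 2 : ℝ) ^ n) (fun n => hfd _ (hδ0 n))
      (fun _ _ => hsum) fun k n x hk => ?_
    have hk' : k ≤ 1 := by exact_mod_cast hk
    interval_cases k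
    · rw [norm_iteratedFDeriv_zero]
      exact (hfn _ (hδ0 n) x).trans (hδle n)
    · rw [norm_iteratedFDeriv_one]
      exact (hfn' _ (hδ0 n) x).trans (hδle n)
  · simp [hh, hxb0]
  · rw [hh, fderiv_tsum_apply hsum (fun n => (hfd _ (hδ0 n)).differentiable one_ne_zero)
      (fun n x => (hfn' _ (hδ0 n) x).trans (hδle n)) (x₀ := xb) (by simp [hxb0, summable_zero]) xb]
    have h1 : ∀ n, fderiv ℝ (f (δ n)) xb = 0 := by
      intro n
      have h2 : f (δ n) =ᶠ[𝓝 xb] fun _ => 0 := by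
        have h3 := hp _ (hδ0 n)
        filter_upwards [Metric.ball_mem_nhds xb (show 0 < ‖p (δ n) - xb‖ / 2 by positivity)]
          with x hx using hxb n x (mem_ball_iff_norm.1 hx)
      rw [h2.fderiv_eq, fderiv_fun_const]
      rfl
    simp [h1]
  · rintro ⟨κ, hκ, ε, hε, hsr⟩
    have h1 : Tendsto (fun n => κ * δ n) atTop (𝓝 0) := by simpa using hδlim.const_mul κ
    obtain ⟨n, hn1, hn2⟩ := ((h1.eventually_lt_const zero_lt_one).and
      (hδlim.eventually_lt_const hε)).exists
    have hd := hδ0 n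
    have hρ' := hρ _ hd
    have h2 := hsr (p (δ n)) (by rw [dist_eq_norm]; exact (hpδ _ hd).trans hn2)
    have hlow : ENNReal.ofReal (ρ (δ n)) ≤
        Metric.infEDist (p (δ n)) {x' | yb ∈ (fun y => h x' + y) '' M x'} := by
      refine Metric.le_infEDist.2 fun x hx => ?_
      obtain ⟨z, hz, hzx⟩ := hx
      rw [edist_comm, edist_dist, dist_eq_norm]
      refine ENNReal.ofReal_le_ofReal (not_lt.1 fun hlt => ?_)
      refine hbad _ hd x hlt z hz ?_
      rw [← hloc n x (hlt.le.trans (hρp _ hd))]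
      exact hzx
    have hup : Metric.infEDist yb ((fun y => h (p (δ n)) + y) '' M (p (δ n))) ≤
        ENNReal.ofReal (δ n * ρ (δ n)) := by
      refine (Metric.infEDist_le_edist_of_mem (mem_image_of_mem _ (hyM _ hd))).trans ?_
      rw [edist_comm, edist_dist, dist_eq_norm, hloc n _ (by simp; positivity)]
      exact ENNReal.ofReal_le_ofReal (hy _ hd)
    have h3 := (hlow.trans h2).trans (mul_le_mul_right hup (ENNReal.ofReal κ))
    rw [← ENNReal.ofReal_mul hκ, ENNReal.ofReal_le_ofReal_iff (by positivity)] at h3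
    nlinarith

/-- Characterizations of `(0,0) ∉ Cr₀ M (xb,yb)`: stability of metric subregularity
under small `C¹` perturbations, and the first-order sufficient condition for metric
subregularity in terms of directional limiting coderivatives (Theorem `ThStabMS`). -/
theorem stmt7 {s d : ℕ} (M : Es s → Set (Es d)) (xb : Es s) (yb : Es d)
    (hcl : IsClosed (gph M)) (hbar : yb ∈ M xb) :
    (((0 : Es d), (0 : Es s)) ∉ Cr0 M xb yb ↔
      ∃ r : ℝ, 0 < r ∧ ∀ h : Es s → Es d, ContDiff ℝ 1 h → h xb = 0 →
        ‖fderiv ℝ h xb‖ ≤ r →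
        MetrSubregAt (fun x => (fun y => h x + y) '' M x) xb yb) ∧
    (((0 : Es d), (0 : Es s)) ∉ Cr0 M xb yb ↔
      ∀ u : Es s, u ≠ 0 → ∀ vs : Es d,
        ((0 : Es s), -vs) ∈ dnc2 (gph M) (xb, yb) (u, 0) → vs = 0) := by
  refine ⟨⟨fun h => ?_, ?_⟩, zero_notMem_Cr0_iff_coderivative⟩
  · rw [zero_mem_Cr0_iff] at h
    push Not at h
    obtain ⟨δ, hδ, hn⟩ := h
    exact ⟨δ / 4, by positivity, fun h hh h0 hd =>
      metrSubregAt_add_of_lt_norm hcl hbar hδ hn hh h0 hd⟩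
  · rintro ⟨r, hr, hsub⟩ hmem
    obtain ⟨h, hh, h0, hd, hnot⟩ := exists_not_metrSubregAt_add hmem
    exact hnot (hsub h hh h0 (by rw [hd, norm_zero]; exact hr.le))
end
end
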